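/- arXiv:2512.12152 — 7 statements merged into one kernel-verified Lean document; each statement's English description precedes it below -/
import Mathlib

section
/- Let b1,…,b5 be functions in the Bell space W_4(T) satisfying the dual-basis conditions: every Bell degree-of-freedom functional (for k=4) vanishes on each b_i, except that b1(1/2,0)=1, b2(1,0)=1, ∂_x b3(1,0)=1, ∂_y b4(1,0)=1, ∂_{xy} b5(1,0)=1, each b_i taking value 1 only at its own designated functional and 0 at all other Bell functionals. Then the 20 degrees of freedom consisting of the values of v, ∂_x v, ∂_y v, ∂_{xy} v at the four vertices of T together with the values of v at the four edge midpoints (1/2,0), (1,1/2), (1/2,1), (0,1/2) uniquely determine the functions of V_4(T) = P_4 + span{b1,…,b5}: if v = p + c1·b1 + … + c5·b5 with p ∈ P_4 and real numbers c1,…,c5 has all 20 of these degrees of freedom equal to zero, then p = 0 and c1 = … = c5 = 0. -/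
open MvPolynomial

noncomputable section

/-- A bivariate real polynomial; variable `0` is `x`, variable `1` is `y`. -/
abbrev Poly2 : Type := MvPolynomial (Fin 2) ℝ

/-- Evaluation of a bivariate polynomial at the point `(a, b)`. -/
def ev (p : Poly2) (a b : ℝ) : ℝ := MvPolynomial.eval ![a, b] p

/-- The partial derivative `∂ₓ`. -/
def dX (p : Poly2) : Poly2 := MvPolynomial.pderiv 0 p

/-- The partial derivative `∂_y`. -/
def dY (p : Poly2) : Poly2 := MvPolynomial.pderiv 1 p

/-- Restriction of `p` to the vertical line `x = c`, as a univariate polynomial in `y`. -/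
def lineX (c : ℝ) (p : Poly2) : Polynomial ℝ :=
  MvPolynomial.aeval (fun i : Fin 2 => if i = 0 then Polynomial.C c else Polynomial.X) p

/-- Restriction of `p` to the horizontal line `y = c`, as a univariate polynomial in `x`. -/
def lineY (c : ℝ) (p : Poly2) : Polynomial ℝ :=
  MvPolynomial.aeval (fun i : Fin 2 => if i = 0 then Polynomial.X else Polynomial.C c) p

/-- The Bell space `W_k(T)` on the unit square: `v ∈ Q_k` such that on each edge the
normal derivative has degree at most `k - 1` in the edge variable. -/
def BellSpace (k : ℕ) (v : Poly2) : Prop :=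
  v.degreeOf 0 ≤ k ∧ v.degreeOf 1 ≤ k ∧
  (lineX 0 (dX v)).natDegree ≤ k - 1 ∧ (lineX 1 (dX v)).natDegree ≤ k - 1 ∧
  (lineY 0 (dY v)).natDegree ≤ k - 1 ∧ (lineY 1 (dY v)).natDegree ≤ k - 1

/-- The set of Bell degree-of-freedom functionals on the unit square, for degree `k`. -/
def BellDofs (k : ℕ) : Set (Poly2 → ℝ) :=
  { F | (∃ i j : ℕ, i ≤ k - 2 ∧ j ≤ k - 2 ∧
          F = fun v => ev v ((i : ℝ) / ((k : ℝ) - 2)) ((j : ℝ) / ((k : ℝ) - 2))) ∨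
        (∃ i j : ℕ, i ≤ 1 ∧ j ≤ k - 3 ∧
          F = fun v => ev (dX v) (i : ℝ) ((j : ℝ) / ((k : ℝ) - 3))) ∨
        (∃ i j : ℕ, i ≤ k - 3 ∧ j ≤ 1 ∧
          F = fun v => ev (dY v) ((i : ℝ) / ((k : ℝ) - 3)) (j : ℝ)) ∨
        (∃ i j : ℕ, i ≤ 1 ∧ j ≤ 1 ∧
          F = fun v => ev (dX (dY v)) (i : ℝ) (j : ℝ)) }

/-- `b` is the Bell nodal basis function dual to the degree-of-freedom functional `F0`:
`F0 b = 1` and every other Bell degree-of-freedom functional vanishes on `b`. -/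
def IsDualTo (k : ℕ) (F0 : Poly2 → ℝ) (b : Poly2) : Prop :=
  F0 b = 1 ∧ ∀ F ∈ BellDofs k, F ≠ F0 → F b = 0

lemma isLinearMap_ev (a b : ℝ) : IsLinearMap ℝ fun v => ev v a b :=
  ⟨fun _ _ => by simp [ev], fun _ _ => by simp [ev, smul_eval]⟩

lemma isLinearMap_ev_dX (a b : ℝ) : IsLinearMap ℝ fun v => ev (dX v) a b :=
  ⟨fun _ _ => by simp [ev, dX], fun _ _ => by simp [ev, dX, smul_eval]⟩

lemma isLinearMap_ev_dY (a b : ℝ) : IsLinearMap ℝ fun v => ev (dY v) a b :=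
  ⟨fun _ _ => by simp [ev, dY], fun _ _ => by simp [ev, dY, smul_eval]⟩

lemma isLinearMap_ev_dX_dY (a b : ℝ) : IsLinearMap ℝ fun v => ev (dX (dY v)) a b :=
  ⟨fun _ _ => by simp [ev, dX, dY], fun _ _ => by simp [ev, dX, dY, smul_eval]⟩

lemma isLinearMap_of_mem_bellDofs {k : ℕ} {F : Poly2 → ℝ} (hF : F ∈ BellDofs k) :
    IsLinearMap ℝ F := by
  rcases hF with ⟨_, _, _, _, rfl⟩ | ⟨_, _, _, _, rfl⟩ | ⟨_, _, _, _, rfl⟩ | ⟨_, _, _, _, rfl⟩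
  · exact isLinearMap_ev _ _
  · exact isLinearMap_ev_dX _ _
  · exact isLinearMap_ev_dY _ _
  · exact isLinearMap_ev_dX_dY _ _

/-- The values at nodes with half-integer coordinates are Bell functionals for `k = 4`. -/
lemma ev_mem_bellDofs_four {a b : ℝ} (i j : ℕ) (hi : i ≤ 2) (hj : j ≤ 2)
    (ha : (i : ℝ) / 2 = a) (hb : (j : ℝ) / 2 = b) : (fun v => ev v a b) ∈ BellDofs 4 := by
  subst ha hb
  exact Or.inl ⟨i, j, hi, hj, by norm_num⟩

lemma ev_dX_mem_bellDofs_four {a b : ℝ} (i j : ℕ) (hi : i ≤ 1) (hj : j ≤ 1)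
    (ha : (i : ℝ) = a) (hb : (j : ℝ) = b) : (fun v => ev (dX v) a b) ∈ BellDofs 4 := by
  subst ha hb
  exact Or.inr (Or.inl ⟨i, j, hi, hj, by norm_num⟩)

lemma ev_dY_mem_bellDofs_four {a b : ℝ} (i j : ℕ) (hi : i ≤ 1) (hj : j ≤ 1)
    (ha : (i : ℝ) = a) (hb : (j : ℝ) = b) : (fun v => ev (dY v) a b) ∈ BellDofs 4 := by
  subst ha hb
  exact Or.inr (Or.inr (Or.inl ⟨i, j, hi, hj, by norm_num⟩))

lemma ev_dX_dY_mem_bellDofs_four {a b : ℝ} (i j : ℕ) (hi : i ≤ 1) (hj : j ≤ 1)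
    (ha : (i : ℝ) = a) (hb : (j : ℝ) = b) : (fun v => ev (dX (dY v)) a b) ∈ BellDofs 4 := by
  subst ha hb
  exact Or.inr (Or.inr (Or.inr ⟨i, j, hi, hj, rfl⟩))

/-- The functionals dual to the enriching functions `b₁, …, b₅`. -/
def enrichingDofs : Fin 5 → Poly2 → ℝ :=
  ![fun v => ev v (1 / 2) 0, fun v => ev v 1 0, fun v => ev (dX v) 1 0, fun v => ev (dY v) 1 0,
    fun v => ev (dX (dY v)) 1 0]

lemma enrichingDofs_mem_bellDofs (i : Fin 5) : enrichingDofs i ∈ BellDofs 4 := by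
  fin_cases i
  · exact ev_mem_bellDofs_four 1 0 (by simp) (by simp) (by simp) (by simp)
  · exact ev_mem_bellDofs_four 2 0 (by simp) (by simp) (by simp) (by simp)
  · exact ev_dX_mem_bellDofs_four 1 0 (by simp) (by simp) (by simp) (by simp)
  · exact ev_dY_mem_bellDofs_four 1 0 (by simp) (by simp) (by simp) (by simp)
  · exact ev_dX_dY_mem_bellDofs_four 1 0 (by simp) (by simp) (by simp) (by simp)

lemma pderiv_ofNat (i : Fin 2) (n : ℕ) [n.AtLeastTwo] :
    pderiv i (ofNat(n) : Poly2) = 0 :=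
  (pderiv i).map_natCast n

/-- A polynomial on which each enriching functional takes a value different from those of the
other nineteen boundary functionals. -/
def separator : Poly2 := 3 * X 0 * X 1 ^ 2 + X 0 ^ 2 - X 0 ^ 2 * X 1

lemma ev_separator (a b : ℝ) : ev separator a b = 3 * a * b ^ 2 + a ^ 2 - a ^ 2 * b := by
  simp [ev, separator]

lemma ev_dX_separator (a b : ℝ) : ev (dX separator) a b = 3 * b ^ 2 + 2 * a - 2 * a * b := by
  simp [ev, dX, separator, pderiv_X, Derivation.leibniz_pow, pderiv_ofNat]
  ring

lemma ev_dY_separator (a b : ℝ) : ev (dY separator) a b = 6 * a * b - a ^ 2 := by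
  simp [ev, dY, separator, pderiv_X, Derivation.leibniz_pow, pderiv_ofNat]
  ring

lemma ev_dX_dY_separator (a b : ℝ) : ev (dX (dY separator)) a b = 6 * b - 2 * a := by
  simp [ev, dX, dY, separator, pderiv_X, Derivation.leibniz_pow, pderiv_ofNat]
  ring

lemma enrichingDofs_separator (i : Fin 5) :
    enrichingDofs i separator = (![1 / 4, 1, 2, -1, -2] : Fin 5 → ℝ) i := by
  fin_cases i <;>
    norm_num [enrichingDofs, ev_separator, ev_dX_separator, ev_dY_separator, ev_dX_dY_separator]

lemma enrichingDofs_injective : Function.Injective enrichingDofs := by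
  intro i j hij
  have h := congrFun hij separator
  rw [enrichingDofs_separator, enrichingDofs_separator] at h
  revert h
  fin_cases i <;> fin_cases j <;> norm_num

/-- A Bell functional whose value on the separator is not one of those of the enriching functionals
does not see the enriching functions. -/
lemma apply_add_sum_eq {b : Fin 5 → Poly2} (hb : ∀ i, IsDualTo 4 (enrichingDofs i) (b i))
    {F : Poly2 → ℝ} (hF : F ∈ BellDofs 4)
    (hsep : ∀ i, F separator ≠ (![1 / 4, 1, 2, -1, -2] : Fin 5 → ℝ) i)
    (p : Poly2) (c : Fin 5 → ℝ) : F (p + ∑ i, c i • b i) = F p := by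
  have hlin := isLinearMap_of_mem_bellDofs hF
  have hFb (i : Fin 5) : F (b i) = 0 := (hb i).2 F hF fun h =>
    hsep i (by rw [h, enrichingDofs_separator])
  change hlin.mk' F _ = hlin.mk' F p
  rw [map_add, map_sum, Finset.sum_eq_zero (by simp [hFb]), add_zero]

lemma enrichingDofs_sum {b : Fin 5 → Poly2} (hb : ∀ i, IsDualTo 4 (enrichingDofs i) (b i))
    (c : Fin 5 → ℝ) (i : Fin 5) : enrichingDofs i (∑ j, c j • b j) = c i := by
  have hF := enrichingDofs_mem_bellDofs i
  have hlin := isLinearMap_of_mem_bellDofs hF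
  change hlin.mk' _ _ = _
  rw [map_sum, Finset.sum_eq_single i]
  · simp [(hb i).1]
  · intro j _ hji
    simp [(hb j).2 _ hF (enrichingDofs_injective.ne hji.symm)]
  · simp

/-- A bivariate polynomial of total degree at most `n` in terms of its coefficients. -/
lemma eq_sum_of_totalDegree_le {p : Poly2} {n : ℕ} (hp : p.totalDegree ≤ n) :
    p = ∑ i ∈ Finset.range (n + 1), ∑ j ∈ Finset.range (n + 1 - i),
      C (p.coeff (Finsupp.single 0 i + Finsupp.single 1 j)) * X 0 ^ i * X 1 ^ j := by
  have hmon (i j : ℕ) (r : ℝ) : (C r * X 0 ^ i * X 1 ^ j : Poly2) =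
      monomial (Finsupp.single 0 i + Finsupp.single 1 j) r := by
    rw [X_pow_eq_monomial, X_pow_eq_monomial, C_mul_monomial, monomial_mul]
    simp
  have hm (m : Fin 2 →₀ ℕ) (i j : ℕ) :
      Finsupp.single 0 i + Finsupp.single 1 j = m ↔ i = m 0 ∧ j = m 1 := by
    simp [Finsupp.ext_iff, Fin.forall_fin_two]
  ext m
  simp only [hmon, coeff_sum, coeff_monomial, hm]
  have hcoeff : coeff m p ≠ 0 → m 0 + m 1 ≤ n := fun h => by
    have := le_totalDegree (mem_support_iff.2 h)
    rw [Finsupp.sum_fintype _ _ (by simp), Fin.sum_univ_two] at this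
    exact this.trans hp
  rw [Finset.sum_eq_single (m 0), Finset.sum_eq_single (m 1)]
  · simp [(hm m (m 0) (m 1)).2]
  · intro j _ hj
    simp [hj]
  · intro hj
    simp only [Finset.mem_range] at hj
    have h0 : coeff m p = 0 := by
      by_contra h
      have := hcoeff h
      omega
    simp [(hm m (m 0) (m 1)).2, h0]
  · intro i _ hi
    simp [hi]
  · intro hi
    simp only [Finset.mem_range] at hi
    apply Finset.sum_eq_zero
    intro j hj
    simp only [Finset.mem_range] at hj
    omega

/-- A quartic is determined by its value, gradient and mixed derivative at the three vertices other
than `(1, 0)` and by its values at the midpoints of the edges other than `y = 0`. -/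
lemma eq_zero_of_dofs_eq_zero {p : Poly2} (hp : p.totalDegree ≤ 4)
    (hvert : ∀ z ∈ ({(0, 0), (1, 1), (0, 1)} : Set (ℝ × ℝ)),
      ev p z.1 z.2 = 0 ∧ ev (dX p) z.1 z.2 = 0 ∧ ev (dY p) z.1 z.2 = 0 ∧
        ev (dX (dY p)) z.1 z.2 = 0)
    (hmid : ∀ z ∈ ({(1, 1 / 2), (1 / 2, 1), (0, 1 / 2)} : Set (ℝ × ℝ)), ev p z.1 z.2 = 0) :
    p = 0 := by
  have hsum := eq_sum_of_totalDegree_le hp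
  generalize hA : (fun i j => p.coeff (Finsupp.single 0 i + Finsupp.single 1 j)) = A at hsum
  have hA' (i j : ℕ) : p.coeff (Finsupp.single 0 i + Finsupp.single 1 j) = A i j := by rw [← hA]
  simp only [hA', Finset.sum_range_succ, Finset.sum_range_zero, Nat.reduceAdd, Nat.reduceSub,
    pow_zero, mul_one, zero_add] at hsum
  clear hA hA' hp
  simp only [Set.forall_mem_insert, Set.mem_singleton_iff, forall_eq] at hvert hmid
  subst hsum
  simp [ev, dX, dY, pderiv_X, Derivation.leibniz_pow, pderiv_ofNat] at hvert hmid
  obtain ⟨⟨h1, h2, h3, h4⟩, ⟨h5, h6, h7, h8⟩, h9, h10, h11, h12⟩ := hvert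
  obtain ⟨h13, h14, h15⟩ := hmid
  have a00 : A 0 0 = 0 := by linarith
  have a10 : A 1 0 = 0 := by linarith
  have a01 : A 0 1 = 0 := by linarith
  have a11 : A 1 1 = 0 := by linarith
  have a02 : A 0 2 = 0 := by linarith
  have a03 : A 0 3 = 0 := by linarith
  have a04 : A 0 4 = 0 := by linarith
  have a12 : A 1 2 = 0 := by linarith
  have a13 : A 1 3 = 0 := by linarith
  have a20 : A 2 0 = 0 := by linarith
  have a21 : A 2 1 = 0 := by linarith
  have a22 : A 2 2 = 0 := by linarith
  have a30 : A 3 0 = 0 := by linarith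
  have a31 : A 3 1 = 0 := by linarith
  have a40 : A 4 0 = 0 := by linarith
  simp [*]

/-- unisolvence of the 20 degrees of freedom for the bubble-enriched
`C¹`-`P₄` element `V₄(T) = P₄ + span{b₁,…,b₅}`. -/
theorem stmt_0
    (b : Fin 5 → Poly2)
    (hW : ∀ i, BellSpace 4 (b i))
    (hb1 : IsDualTo 4 (fun v => ev v (1 / 2) 0) (b 0))
    (hb2 : IsDualTo 4 (fun v => ev v 1 0) (b 1))
    (hb3 : IsDualTo 4 (fun v => ev (dX v) 1 0) (b 2))
    (hb4 : IsDualTo 4 (fun v => ev (dY v) 1 0) (b 3))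
    (hb5 : IsDualTo 4 (fun v => ev (dX (dY v)) 1 0) (b 4))
    (p : Poly2) (hp : p.totalDegree ≤ 4) (c : Fin 5 → ℝ)
    (v : Poly2) (hv : v = p + ∑ i, c i • b i)
    (hvert : ∀ z ∈ ({(0, 0), (1, 0), (1, 1), (0, 1)} : Set (ℝ × ℝ)),
      ev v z.1 z.2 = 0 ∧ ev (dX v) z.1 z.2 = 0 ∧ ev (dY v) z.1 z.2 = 0 ∧
        ev (dX (dY v)) z.1 z.2 = 0)
    (hmid : ∀ z ∈ ({(1 / 2, 0), (1, 1 / 2), (1 / 2, 1), (0, 1 / 2)} : Set (ℝ × ℝ)),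
      ev v z.1 z.2 = 0) :
    p = 0 ∧ ∀ i, c i = 0 := by
  have hb : ∀ i, IsDualTo 4 (enrichingDofs i) (b i) := by
    intro i
    fin_cases i
    exacts [hb1, hb2, hb3, hb4, hb5]
  simp only [Set.forall_mem_insert, Set.mem_singleton_iff, forall_eq, hv] at hvert hmid
  obtain ⟨h00, h10, h11, h01⟩ := hvert
  obtain ⟨hm1, hm2, hm3, hm4⟩ := hmid
  have key {F : Poly2 → ℝ} (hF : F ∈ BellDofs 4)
      (hsep : ∀ i, F separator ≠ (![1 / 4, 1, 2, -1, -2] : Fin 5 → ℝ) i)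
      (h : F (p + ∑ i, c i • b i) = 0) : F p = 0 :=
    (apply_add_sum_eq hb hF hsep p c).symm.trans h
  have hvertex {a d : ℝ} (i j : ℕ) (hi : i ≤ 1) (hj : j ≤ 1) (hij : i ≤ j) (ha : (i : ℝ) = a)
      (hd : (j : ℝ) = d)
      (h : ev (p + ∑ i, c i • b i) a d = 0 ∧ ev (dX (p + ∑ i, c i • b i)) a d = 0 ∧
        ev (dY (p + ∑ i, c i • b i)) a d = 0 ∧ ev (dX (dY (p + ∑ i, c i • b i))) a d = 0) :
      ev p a d = 0 ∧ ev (dX p) a d = 0 ∧ ev (dY p) a d = 0 ∧ ev (dX (dY p)) a d = 0 := by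
    subst ha hd
    refine ⟨key (F := fun v => ev v i j) (ev_mem_bellDofs_four (2 * i) (2 * j) (by omega)
        (by omega) (by push_cast; ring) (by push_cast; ring)) ?_ h.1,
      key (F := fun v => ev (dX v) i j) (ev_dX_mem_bellDofs_four i j hi hj rfl rfl) ?_ h.2.1,
      key (F := fun v => ev (dY v) i j) (ev_dY_mem_bellDofs_four i j hi hj rfl rfl) ?_ h.2.2.1,
      key (F := fun v => ev (dX (dY v)) i j) (ev_dX_dY_mem_bellDofs_four i j hi hj rfl rfl) ?_
        h.2.2.2⟩ <;>
    simp only [ev_separator, ev_dX_separator, ev_dY_separator, ev_dX_dY_separator] <;>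
    interval_cases i <;> interval_cases j <;> first | omega | norm_num [Fin.forall_fin_succ]
  have hmidpoint {a d : ℝ} (i j : ℕ) (hi : i ≤ 2) (hj : j ≤ 2) (ha : (i : ℝ) / 2 = a)
      (hd : (j : ℝ) / 2 = d)
      (hsep : ∀ i, ev separator a d ≠ (![1 / 4, 1, 2, -1, -2] : Fin 5 → ℝ) i)
      (h : ev (p + ∑ i, c i • b i) a d = 0) : ev p a d = 0 :=
    key (F := fun v => ev v a d) (ev_mem_bellDofs_four i j hi hj ha hd) hsep h
  have hp0 : p = 0 := by
    apply eq_zero_of_dofs_eq_zero hp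
    · simp only [Set.forall_mem_insert, Set.mem_singleton_iff, forall_eq]
      exact ⟨hvertex 0 0 (by simp) (by simp) (by simp) (by simp) (by simp) h00,
        hvertex 1 1 (by simp) (by simp) (by simp) (by simp) (by simp) h11,
        hvertex 0 1 (by simp) (by simp) (by simp) (by simp) (by simp) h01⟩
    · simp only [Set.forall_mem_insert, Set.mem_singleton_iff, forall_eq]
      refine ⟨hmidpoint 2 1 (by simp) (by simp) (by simp) (by simp) ?_ hm2,
        hmidpoint 1 2 (by simp) (by simp) (by simp) (by simp) ?_ hm3,
        hmidpoint 0 1 (by simp) (by simp) (by simp) (by simp) ?_ hm4⟩ <;>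
      norm_num [Fin.forall_fin_succ, ev_separator]
  refine ⟨hp0, fun i => ?_⟩
  rw [hp0, zero_add] at hm1 h10
  rw [← enrichingDofs_sum hb c i]
  fin_cases i
  exacts [hm1, h10.1, h10.2.1, h10.2.2.1, h10.2.2.2]
end
end

section
/- Let b1,…,b7 be functions in the Bell space W_5(T) satisfying the dual-basis conditions: every Bell degree-of-freedom functional (for k=5) vanishes on each b_i, except that b1(1/3,0)=1, b2(2/3,0)=1, b3(1,0)=1, ∂_y b4(1/2,0)=1, ∂_x b5(1,0)=1, ∂_y b6(1,0)=1, ∂_{xy} b7(1,0)=1, each b_i taking value 1 only at its own designated functional and 0 at all other Bell functionals. Then the 28 degrees of freedom consisting of the values of v, ∂_x v, ∂_y v, ∂_{xy} v at the four vertices of T, the values of v at the eight points (1/3,0), (2/3,0), (1,1/3), (1,2/3), (1/3,1), (2/3,1), (0,1/3), (0,2/3), and the normal derivatives ∂_y v(1/2,0), ∂_y v(1/2,1), ∂_x v(0,1/2), ∂_x v(1,1/2) uniquely determine the functions of V_5(T) = P_5 + span{b1,…,b7}: if v = p + c1·b1 + … + c7·b7 with p ∈ P_5 and real numbers c1,…,c7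 has all 28 of these degrees of freedom equal to zero, then p = 0 and c1 = … = c7 = 0. -/
open MvPolynomial

noncomputable section

/-- The functional `v ↦ ∂ₓᵐ ∂_yⁿ v (a, b)`. -/
def derivAt (m n : ℕ) (a b : ℝ) : Poly2 →ₗ[ℝ] ℝ :=
  (aeval ![a, b]).toLinearMap ∘ₗ
    ((pderiv 0 : Derivation ℝ Poly2 Poly2).toLinearMap ^ m) ∘ₗ
    ((pderiv 1 : Derivation ℝ Poly2 Poly2).toLinearMap ^ n)

lemma derivAt_zero_zero (a b : ℝ) (v : Poly2) : derivAt 0 0 a b v = ev v a b := by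
  simp [derivAt, ev, aeval_eq_eval]

lemma derivAt_one_zero (a b : ℝ) (v : Poly2) : derivAt 1 0 a b v = ev (dX v) a b := by
  simp [derivAt, ev, dX, aeval_eq_eval]

lemma derivAt_zero_one (a b : ℝ) (v : Poly2) : derivAt 0 1 a b v = ev (dY v) a b := by
  simp [derivAt, ev, dY, aeval_eq_eval]

lemma derivAt_one_one (a b : ℝ) (v : Poly2) : derivAt 1 1 a b v = ev (dX (dY v)) a b := by
  simp [derivAt, ev, dX, dY, aeval_eq_eval]

lemma derivAt_X_pow_mul_X_pow (m n i j : ℕ) (a b : ℝ) :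
    derivAt m n a b (X 0 ^ i * X 1 ^ j) =
      i.descFactorial m * j.descFactorial n * a ^ (i - m) * b ^ (j - n) := by
  have hy : ∀ n : ℕ, ((pderiv 1 : Derivation ℝ Poly2 Poly2).toLinearMap ^ n)
      (X 0 ^ i * X 1 ^ j) = (j.descFactorial n : ℝ) • (X 0 ^ i * X 1 ^ (j - n)) := by
    intro n
    induction n with
    | zero => simp
    | succ n ih =>
      rw [pow_succ', Module.End.mul_apply, ih, map_smul]
      simp [Derivation.leibniz_pow, Nat.descFactorial_succ, pderiv_X, smul_eq_C_mul, Nat.sub_sub]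
      ring
  have hx : ∀ m : ℕ, ((pderiv 0 : Derivation ℝ Poly2 Poly2).toLinearMap ^ m)
      (X 0 ^ i * X 1 ^ (j - n)) =
        (i.descFactorial m : ℝ) • (X 0 ^ (i - m) * X 1 ^ (j - n)) := by
    intro m
    induction m with
    | zero => simp
    | succ m ih =>
      rw [pow_succ', Module.End.mul_apply, ih, map_smul]
      simp [Derivation.leibniz_pow, Nat.descFactorial_succ, pderiv_X, smul_eq_C_mul, Nat.sub_sub]
      ring
  simp only [derivAt, LinearMap.comp_apply, hy, map_smul, hx]
  simp
  ring

/-- Functionals of order at most one in each variable are determined by their symbol. -/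
lemma derivAt_injective {m n m' n' : ℕ} {a b a' b' : ℝ}
    (hm : m ≤ 1) (hn : n ≤ 1) (hm' : m' ≤ 1) (hn' : n' ≤ 1)
    (h : derivAt m n a b = derivAt m' n' a' b') :
    (m, n, a, b) = (m', n', a', b') := by
  have key (i j : ℕ) := congrArg (fun L => L (X 0 ^ i * X 1 ^ j)) h
  simp only [derivAt_X_pow_mul_X_pow] at key
  have h00 := key 0 0
  have h10 := key 1 0
  have h01 := key 0 1
  have h11 := key 1 1
  have h20 := key 2 0
  have h02 := key 0 2
  have h21 := key 2 1
  have h12 := key 1 2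
  clear key
  interval_cases m <;> interval_cases n <;> interval_cases m' <;> interval_cases n' <;>
    simp_all [Nat.descFactorial]

lemma eq_sum_coeff_mul_X_pow {d : ℕ} {p : Poly2} (hp : p.totalDegree ≤ d) :
    p = ∑ i ∈ Finset.range (d + 1), ∑ j ∈ Finset.range (d + 1),
      p.coeff (Finsupp.single 0 i + Finsupp.single 1 j) • (X 0 ^ i * X 1 ^ j) := by
  ext s
  have hs : s = Finsupp.single 0 (s 0) + Finsupp.single 1 (s 1) := by
    ext k; fin_cases k <;> simp
  have hmon (i j : ℕ) : (X 0 ^ i * X 1 ^ j : Poly2) =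
      monomial (Finsupp.single 0 i + Finsupp.single 1 j) 1 := by
    simp [X_pow_eq_monomial, monomial_mul]
  have hinj (i j : ℕ) :
      (Finsupp.single 0 i + Finsupp.single 1 j = s) ↔ (i = s 0 ∧ j = s 1) := by
    constructor
    · rintro rfl; simp
    · rintro ⟨rfl, rfl⟩; exact hs.symm
  simp only [coeff_sum, hmon, coeff_smul, coeff_monomial, hinj, ite_and, smul_eq_mul, mul_ite,
    mul_one, mul_zero]
  by_cases h : s 0 + s 1 ≤ d
  · have h0 : s 0 < d + 1 := by omega
    have h1 : s 1 < d + 1 := by omega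
    simp [Finset.sum_ite_eq', ← hs, h0, h1]
  · have hc : p.coeff s = 0 := by
      apply coeff_eq_zero_of_totalDegree_lt
      rw [← Finsupp.degree_apply, Finsupp.degree_eq_sum, Fin.sum_univ_two]
      omega
    simp [Finset.sum_ite_eq', ← hs, hc]

set_option maxHeartbeats 1000000 in
/-- Unisolvence of `P₅` for those degrees of freedom that vanish on all seven bubbles. -/
lemma eq_zero_of_derivAt_eq_zero {p : Poly2} (hp : p.totalDegree ≤ 5)
    (hvert : ∀ z ∈ ({(0, 0), (0, 1), (1, 1)} : Set (ℝ × ℝ)), ∀ m ≤ 1, ∀ n ≤ 1,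
      derivAt m n z.1 z.2 p = 0)
    (hedge : ∀ z ∈ ({(0, 1 / 3), (0, 2 / 3), (1 / 3, 1), (2 / 3, 1), (1, 1 / 3), (1, 2 / 3)} :
      Set (ℝ × ℝ)), derivAt 0 0 z.1 z.2 p = 0)
    (hx0 : derivAt 1 0 0 (1 / 2) p = 0) (hx1 : derivAt 1 0 1 (1 / 2) p = 0)
    (hy1 : derivAt 0 1 (1 / 2) 1 p = 0) : p = 0 := by
  have hsum := eq_sum_coeff_mul_X_pow hp
  have hhigh (i j : ℕ) (h : 5 < i + j) :
      p.coeff (Finsupp.single 0 i + Finsupp.single 1 j) = 0 := by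
    apply coeff_eq_zero_of_totalDegree_lt
    rw [← Finsupp.degree_apply]
    simp
    omega
  generalize hA : (fun i j : ℕ => p.coeff (Finsupp.single 0 i + Finsupp.single 1 j)) = A at *
  simp only [fun i j => congrFun (congrFun hA i) j] at hsum hhigh
  have hD (m n : ℕ) (a b : ℝ) : derivAt m n a b p = ∑ i ∈ Finset.range 6,
      ∑ j ∈ Finset.range 6, A i j *
        (i.descFactorial m * j.descFactorial n * a ^ (i - m) * b ^ (j - n)) := by
    rw [hsum]
    simp only [map_sum, map_smul, derivAt_X_pow_mul_X_pow, smul_eq_mul]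
  simp only [Set.mem_insert_iff, Set.mem_singleton_iff, forall_eq_or_imp, forall_eq] at hvert hedge
  obtain ⟨h00, h01, h11⟩ := hvert
  obtain ⟨e1, e2, e3, e4, e5, e6⟩ := hedge
  have A00 := h00 0 (by simp) 0 (by simp)
  have A10 := h00 1 (by simp) 0 (by simp)
  have A01 := h00 0 (by simp) 1 (by simp)
  have A11 := h00 1 (by simp) 1 (by simp)
  have f00 := h01 0 (by simp) 0 (by simp)
  have f10 := h01 1 (by simp) 0 (by simp)
  have f01 := h01 0 (by simp) 1 (by simp)
  have f11 := h01 1 (by simp) 1 (by simp)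
  have g00 := h11 0 (by simp) 0 (by simp)
  have g10 := h11 1 (by simp) 0 (by simp)
  have g01 := h11 0 (by simp) 1 (by simp)
  have g11 := h11 1 (by simp) 1 (by simp)
  clear h00 h01 h11
  simp [hD, Finset.sum_range_succ, hhigh, Nat.descFactorial] at A00 A01 A10 A11
  simp [hD, Finset.sum_range_succ, hhigh, Nat.descFactorial, A00, A01, A10, A11]
    at f00 f01 e1 e2
  have A02 : A 0 2 = 0 := by linarith only [f00, f01, e1, e2]
  have A03 : A 0 3 = 0 := by linarith only [f00, f01, e1, e2]
  have A04 : A 0 4 = 0 := by linarith only [f00, f01, e1, e2]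
  have A05 : A 0 5 = 0 := by linarith only [f00, f01, e1, e2]
  simp [hD, Finset.sum_range_succ, hhigh, Nat.descFactorial, A00, A01, A10, A11] at f10 f11 hx0
  have A12 : A 1 2 = 0 := by linarith only [f10, f11, hx0]
  have A13 : A 1 3 = 0 := by linarith only [f10, f11, hx0]
  have A14 : A 1 4 = 0 := by linarith only [f10, f11, hx0]
  simp [hD, Finset.sum_range_succ, hhigh, Nat.descFactorial, A00, A01, A10, A11, A02, A03, A04,
    A05, A12, A13, A14] at g00 g10 g01 g11 e3 e4 e5 e6 hx1 hy1
  have A20 : A 2 0 = 0 := by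
    linarith only [g00, g10, g01, g11, e3, e4, e5, e6, hx1, hy1]
  have A21 : A 2 1 = 0 := by
    linarith only [g00, g10, g01, g11, e3, e4, e5, e6, hx1, hy1]
  have A22 : A 2 2 = 0 := by
    linarith only [g00, g10, g01, g11, e3, e4, e5, e6, hx1, hy1]
  have A23 : A 2 3 = 0 := by
    linarith only [g00, g10, g01, g11, e3, e4, e5, e6, hx1, hy1]
  have A30 : A 3 0 = 0 := by
    linarith only [g00, g10, g01, g11, e3, e4, e5, e6, hx1, hy1]
  have A31 : A 3 1 = 0 := by
    linarith only [g00, g10, g01, g11, e3, e4, e5, e6, hx1, hy1]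
  have A32 : A 3 2 = 0 := by
    linarith only [g00, g10, g01, g11, e3, e4, e5, e6, hx1, hy1]
  have A40 : A 4 0 = 0 := by
    linarith only [g00, g10, g01, g11, e3, e4, e5, e6, hx1, hy1]
  have A41 : A 4 1 = 0 := by
    linarith only [g00, g10, g01, g11, e3, e4, e5, e6, hx1, hy1]
  have A50 : A 5 0 = 0 := by
    linarith only [g00, g10, g01, g11, e3, e4, e5, e6, hx1, hy1]
  rw [hsum]
  simp [Finset.sum_range_succ, *]

lemma derivAt_zero_zero_mem_BellDofs {i j : ℕ} (hi : i ≤ 3) (hj : j ≤ 3) :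
    ⇑(derivAt 0 0 (i / 3) (j / 3)) ∈ BellDofs 5 := by
  refine Or.inl ⟨i, j, hi, hj, funext fun v => ?_⟩
  rw [derivAt_zero_zero]
  norm_num

lemma derivAt_one_zero_mem_BellDofs {i j : ℕ} (hi : i ≤ 1) (hj : j ≤ 2) :
    ⇑(derivAt 1 0 i (j / 2)) ∈ BellDofs 5 := by
  refine Or.inr (Or.inl ⟨i, j, hi, hj, funext fun v => ?_⟩)
  rw [derivAt_one_zero]
  norm_num

lemma derivAt_zero_one_mem_BellDofs {i j : ℕ} (hi : i ≤ 2) (hj : j ≤ 1) :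
    ⇑(derivAt 0 1 (i / 2) j) ∈ BellDofs 5 := by
  refine Or.inr (Or.inr (Or.inl ⟨i, j, hi, hj, funext fun v => ?_⟩))
  rw [derivAt_zero_one]
  norm_num

lemma derivAt_one_one_mem_BellDofs {i j : ℕ} (hi : i ≤ 1) (hj : j ≤ 1) :
    ⇑(derivAt 1 1 i j) ∈ BellDofs 5 :=
  Or.inr (Or.inr (Or.inr ⟨i, j, hi, hj, funext fun v => derivAt_one_one _ _ v⟩))

lemma derivAt_vertex_mem_BellDofs {m n i j : ℕ} (hm : m ≤ 1) (hn : n ≤ 1) (hi : i ≤ 1)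
    (hj : j ≤ 1) : ⇑(derivAt m n i j) ∈ BellDofs 5 := by
  interval_cases m <;> interval_cases n
  · convert derivAt_zero_zero_mem_BellDofs (i := 3 * i) (j := 3 * j) (by omega) (by omega) using 3
      <;> push_cast <;> ring
  · convert derivAt_zero_one_mem_BellDofs (i := 2 * i) (j := j) (by omega) hj using 3
    push_cast; ring
  · convert derivAt_one_zero_mem_BellDofs (i := i) (j := 2 * j) hi (by omega) using 3
    push_cast; ring
  · exact derivAt_one_one_mem_BellDofs hi hj

/-- The symbols `(m, n, a, b)` of the functionals to which the seven bubbles are dual. -/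
def bubbleSymbol : Fin 7 → ℕ × ℕ × ℝ × ℝ :=
  ![(0, 0, 1 / 3, 0), (0, 0, 2 / 3, 0), (0, 0, 1, 0), (0, 1, 1 / 2, 0), (1, 0, 1, 0),
    (0, 1, 1, 0), (1, 1, 1, 0)]

open scoped Classical in
lemma IsDualTo.derivAt_eq {k m n m' n' : ℕ} {a b a' b' : ℝ} {w : Poly2}
    (hw : IsDualTo k (derivAt m' n' a' b') w)
    (hm : m ≤ 1) (hn : n ≤ 1) (hm' : m' ≤ 1) (hn' : n' ≤ 1)
    (hmem : ⇑(derivAt m n a b) ∈ BellDofs k) :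
    derivAt m n a b w = if (m, n, a, b) = (m', n', a', b') then 1 else 0 := by
  split_ifs with h
  · simp only [Prod.mk.injEq] at h
    obtain ⟨rfl, rfl, rfl, rfl⟩ := h
    exact hw.1
  · exact hw.2 _ hmem fun h' => h (derivAt_injective hm hn hm' hn' (DFunLike.coe_injective h'))

/-- unisolvence of the 28 degrees of freedom for the bubble-enriched
`C¹`-`P₅` element `V₅(T) = P₅ + span{b₁,…,b₇}`. -/
theorem stmt_1
    (b : Fin 7 → Poly2)
    (hW : ∀ i, BellSpace 5 (b i))
    (hb1 : IsDualTo 5 (fun v => ev v (1 / 3) 0) (b 0))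
    (hb2 : IsDualTo 5 (fun v => ev v (2 / 3) 0) (b 1))
    (hb3 : IsDualTo 5 (fun v => ev v 1 0) (b 2))
    (hb4 : IsDualTo 5 (fun v => ev (dY v) (1 / 2) 0) (b 3))
    (hb5 : IsDualTo 5 (fun v => ev (dX v) 1 0) (b 4))
    (hb6 : IsDualTo 5 (fun v => ev (dY v) 1 0) (b 5))
    (hb7 : IsDualTo 5 (fun v => ev (dX (dY v)) 1 0) (b 6))
    (p : Poly2) (hp : p.totalDegree ≤ 5) (c : Fin 7 → ℝ)
    (v : Poly2) (hv : v = p + ∑ i, c i • b i)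
    (hvert : ∀ z ∈ ({(0, 0), (1, 0), (1, 1), (0, 1)} : Set (ℝ × ℝ)),
      ev v z.1 z.2 = 0 ∧ ev (dX v) z.1 z.2 = 0 ∧ ev (dY v) z.1 z.2 = 0 ∧
        ev (dX (dY v)) z.1 z.2 = 0)
    (hedge : ∀ z ∈ ({(1 / 3, 0), (2 / 3, 0), (1, 1 / 3), (1, 2 / 3),
        (1 / 3, 1), (2 / 3, 1), (0, 1 / 3), (0, 2 / 3)} : Set (ℝ × ℝ)),
      ev v z.1 z.2 = 0)
    (hny1 : ev (dY v) (1 / 2) 0 = 0) (hny2 : ev (dY v) (1 / 2) 1 = 0)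
    (hnx1 : ev (dX v) 0 (1 / 2) = 0) (hnx2 : ev (dX v) 1 (1 / 2) = 0) :
    p = 0 ∧ ∀ i, c i = 0 := by
  classical
  simp only [← derivAt_one_one] at *
  simp only [← derivAt_one_zero, ← derivAt_zero_one] at *
  simp only [← derivAt_zero_zero] at *
  have hdual (m n : ℕ) (x y : ℝ) (hm : m ≤ 1) (hn : n ≤ 1)
      (hmem : ⇑(derivAt m n x y) ∈ BellDofs 5) (i : Fin 7) :
      derivAt m n x y (b i) = if (m, n, x, y) = bubbleSymbol i then 1 else 0 := by
    fin_cases i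
    · exact hb1.derivAt_eq hm hn (by simp) (by simp) hmem
    · exact hb2.derivAt_eq hm hn (by simp) (by simp) hmem
    · exact hb3.derivAt_eq hm hn (by simp) (by simp) hmem
    · exact hb4.derivAt_eq hm hn (by simp) (by simp) hmem
    · exact hb5.derivAt_eq hm hn (by simp) (by simp) hmem
    · exact hb6.derivAt_eq hm hn (by simp) (by simp) hmem
    · exact hb7.derivAt_eq hm hn (by simp) (by simp) hmem
  have hval (m n : ℕ) (x y : ℝ) (hm : m ≤ 1) (hn : n ≤ 1)
      (hmem : ⇑(derivAt m n x y) ∈ BellDofs 5) :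
      derivAt m n x y p + ∑ i, (if (m, n, x, y) = bubbleSymbol i then c i else 0) =
        derivAt m n x y v := by
    simp [hv, hdual m n x y hm hn hmem]
  have hvertex (i j m n : ℕ) (hi : i ≤ 1) (hj : j ≤ 1) (hm : m ≤ 1) (hn : n ≤ 1) :=
    hval m n i j hm hn (derivAt_vertex_mem_BellDofs hm hn hi hj)
  have hpoint (i j : ℕ) (hi : i ≤ 3) (hj : j ≤ 3) :=
    hval 0 0 (i / 3) (j / 3) (by simp) (by simp) (derivAt_zero_zero_mem_BellDofs hi hj)
  have hx (i j : ℕ) (hi : i ≤ 1) (hj : j ≤ 2) :=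
    hval 1 0 i (j / 2) (by simp) (by simp) (derivAt_one_zero_mem_BellDofs hi hj)
  have hy (i j : ℕ) (hi : i ≤ 2) (hj : j ≤ 1) :=
    hval 0 1 (i / 2) j (by simp) (by simp) (derivAt_zero_one_mem_BellDofs hi hj)
  simp only [Set.mem_insert_iff, Set.mem_singleton_iff, forall_eq_or_imp, forall_eq]
    at hvert hedge
  have hp0 : p = 0 := by
    refine eq_zero_of_derivAt_eq_zero hp ?_ ?_ ?_ ?_ ?_
    · simp only [Set.mem_insert_iff, Set.mem_singleton_iff, forall_eq_or_imp, forall_eq]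
      refine ⟨fun m hm n hn => ?_, fun m hm n hn => ?_, fun m hm n hn => ?_⟩
      · have := hvertex 0 0 m n (by simp) (by simp) hm hn
        interval_cases m <;> interval_cases n <;>
          norm_num [hvert, bubbleSymbol, Fin.sum_univ_succ] at this <;> exact this
      · have := hvertex 0 1 m n (by simp) (by simp) hm hn
        interval_cases m <;> interval_cases n <;>
          norm_num [hvert, bubbleSymbol, Fin.sum_univ_succ] at this <;> exact this
      · have := hvertex 1 1 m n (by simp) (by simp) hm hn
        interval_cases m <;> interval_cases n <;>
          norm_num [hvert, bubbleSymbol, Fin.sum_univ_succ] at this <;> exact this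
    · simp only [Set.mem_insert_iff, Set.mem_singleton_iff, forall_eq_or_imp, forall_eq]
      refine ⟨?_, ?_, ?_, ?_, ?_, ?_⟩
      · have := hpoint 0 1 (by simp) (by simp)
        norm_num [hedge, bubbleSymbol, Fin.sum_univ_succ] at this ⊢; exact this
      · have := hpoint 0 2 (by simp) (by simp)
        norm_num [hedge, bubbleSymbol, Fin.sum_univ_succ] at this ⊢; exact this
      · have := hpoint 1 3 (by simp) (by simp)
        norm_num [hedge, bubbleSymbol, Fin.sum_univ_succ] at this ⊢; exact this
      · have := hpoint 2 3 (by simp) (by simp)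
        norm_num [hedge, bubbleSymbol, Fin.sum_univ_succ] at this ⊢; exact this
      · have := hpoint 3 1 (by simp) (by simp)
        norm_num [hedge, bubbleSymbol, Fin.sum_univ_succ] at this ⊢; exact this
      · have := hpoint 3 2 (by simp) (by simp)
        norm_num [hedge, bubbleSymbol, Fin.sum_univ_succ] at this ⊢; exact this
    · have := hx 0 1 (by simp) (by simp)
      norm_num [hnx1, bubbleSymbol, Fin.sum_univ_succ] at this ⊢; exact this
    · have := hx 1 1 (by simp) (by simp)
      norm_num [hnx2, bubbleSymbol, Fin.sum_univ_succ] at this ⊢; exact this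
    · have := hy 1 1 (by simp) (by simp)
      norm_num [hny2, bubbleSymbol, Fin.sum_univ_succ] at this ⊢; exact this
  refine ⟨hp0, fun i => ?_⟩
  fin_cases i
  · have := hpoint 1 0 (by simp) (by simp)
    norm_num [hp0, hedge, bubbleSymbol, Fin.sum_univ_succ] at this ⊢; exact this
  · have := hpoint 2 0 (by simp) (by simp)
    norm_num [hp0, hedge, bubbleSymbol, Fin.sum_univ_succ] at this ⊢; exact this
  · have := hvertex 1 0 0 0 (by simp) (by simp) (by simp) (by simp)
    norm_num [hp0, hvert, bubbleSymbol, Fin.sum_univ_succ] at this ⊢; exact this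
  · have := hy 1 0 (by simp) (by simp)
    norm_num [hp0, hny1, bubbleSymbol, Fin.sum_univ_succ] at this ⊢; exact this
  · have := hvertex 1 0 1 0 (by simp) (by simp) (by simp) (by simp)
    norm_num [hp0, hvert, bubbleSymbol, Fin.sum_univ_succ] at this ⊢; exact this
  · have := hvertex 1 0 0 1 (by simp) (by simp) (by simp) (by simp)
    norm_num [hp0, hvert, bubbleSymbol, Fin.sum_univ_succ] at this ⊢; exact this
  · have := hvertex 1 0 1 1 (by simp) (by simp) (by simp) (by simp)
    norm_num [hp0, hvert, bubbleSymbol, Fin.sum_univ_succ] at this ⊢; exact this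
end
end

section
/- Let k ≥ 6 and let b1,…,b8 be functions in the Bell space W_k(T) satisfying the dual-basis conditions: every Bell degree-of-freedom functional (for this k) vanishes on each b_i, except that b1(1/(k−2),0)=1, b2(2/(k−2),0)=1, ∂_y b3(1/(k−3),0)=1, ∂_y b4(2/(k−3),0)=1, b5(1,0)=1, ∂_x b6(1,0)=1, ∂_y b7(1,0)=1, ∂_{xy} b8(1,0)=1, each b_i taking value 1 only at its own designated functional and 0 at all other Bell functionals. Consider the degrees of freedom: the values of v, ∂_x v, ∂_y v, ∂_{xy} v at the four vertices of T; the values of v at the edge points (j/(k−2),0), (j/(k−2),1), (0,j/(k−2)), (1,j/(k−2)) for j = 1,…,k−3; the normal derivatives ∂_y v(j/(k−3),0), ∂_y v(j/(k−3),1), ∂_x v(0,j/(k−3)), ∂_x v(1,j/(k−3)) for j = 1,…,k−4; and, when k > 7, the values of v at the interior points (i/(k−2), j/(k−2)) for integers 1 ≤ j ≤ i ≤ k−7. These degrees of freedom uniquely determine the functions of V_k(T) = P_k + span{b1,…,b8}: if v = p + c1·b1 + … + c8·b8 with p ∈ P_k and real numbers c1,…,c8 has all of these degrees of freedom equal to zero,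 then p = 0 and c1 = … = c8 = 0. -/
open MvPolynomial

noncomputable section

/-- Restriction of a bivariate polynomial to the line on which variable `i` equals `c`. -/
def restrictLine (i : Fin 2) (c : ℝ) (p : Poly2) : Polynomial ℝ :=
  MvPolynomial.aeval (fun l => if l = i then Polynomial.C c else Polynomial.X) p

/-- The functional of type `T.1` at the point `T.2`: the types `0, 1, 2, 3` stand for the values
of `v`, `∂ₓ v`, `∂_y v` and `∂_{xy} v`. -/
def dof (T : Fin 4 × ℝ × ℝ) (v : Poly2) : ℝ :=
  ev (![v, dX v, dY v, dX (dY v)] T.1) T.2.1 T.2.2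

/-- `p` has total degree less than `m`, the zero polynomial being included for every `m`. -/
def DegLT (m : ℕ) (p : Poly2) : Prop := p = 0 ∨ p.totalDegree < m

lemma Polynomial.eq_zero_of_double_roots (f : Polynomial ℝ) (S D : Finset ℝ) (hDS : D ⊆ S)
    (hf : f.natDegree < S.card + D.card) (hS : ∀ t ∈ S, f.eval t = 0)
    (hD : ∀ t ∈ D, f.derivative.eval t = 0) : f = 0 := by
  by_contra h0
  have hle : S.val + D.val ≤ f.roots := by
    rw [Multiset.le_iff_count]
    intro t
    rw [Multiset.count_add, Polynomial.count_roots,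
      Multiset.count_eq_of_nodup S.nodup, Multiset.count_eq_of_nodup D.nodup]
    simp only [Finset.mem_val]
    by_cases hd : t ∈ D
    · have := (Polynomial.one_lt_rootMultiplicity_iff_isRoot (p := f) (t := t) h0).2
        ⟨hS t (hDS hd), hD t hd⟩
      simp only [hDS hd, hd, if_true]
      omega
    · by_cases hs : t ∈ S
      · have := (Polynomial.rootMultiplicity_pos h0).2 (hS t hs)
        simp only [hs, hd, if_true, if_false]
        omega
      · simp [hs, hd]
  have h1 := Multiset.card_le_card hle
  have h2 := f.card_roots'
  simp only [Multiset.card_add, Finset.card_val] at h1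
  omega

lemma eval_restrictLine (i : Fin 2) (c t : ℝ) (p : Poly2) :
    (restrictLine i c p).eval t = MvPolynomial.eval (fun l => if l = i then c else t) p := by
  unfold restrictLine
  induction p using MvPolynomial.induction_on with
  | C a => simp
  | add p q hp hq => simp only [map_add, Polynomial.eval_add, hp, hq]
  | mul_X p l hp =>
    simp only [map_mul, Polynomial.eval_mul, hp, aeval_X, eval_X]
    split_ifs <;> simp

lemma derivative_restrictLine {i j : Fin 2} (hij : j ≠ i) (c : ℝ) (p : Poly2) :
    Polynomial.derivative (restrictLine i c p) = restrictLine i c (pderiv j p) := by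
  unfold restrictLine
  induction p using MvPolynomial.induction_on with
  | C a => simp
  | add p q hp hq => simp only [map_add, hp, hq]
  | mul_X p l hp =>
    rw [Derivation.leibniz]
    simp only [map_mul, Polynomial.derivative_mul, hp, aeval_X, map_add, smul_eq_mul]
    by_cases hl : l = i
    · subst hl
      simp [pderiv_X_of_ne hij.symm]
      ring
    · have : l = j := by omega
      subst this
      simp [hij]
      ring

lemma natDegree_restrictLine_le (i : Fin 2) (c : ℝ) (p : Poly2) :
    (restrictLine i c p).natDegree ≤ p.totalDegree := by
  unfold restrictLine
  refine (MvPolynomial.aeval_natDegree_le (n := 1) p le_rfl _ ?_).trans (by simp)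
  intro l
  split_ifs <;> simp

lemma X_sub_C_dvd_of_restrictLine_eq_zero {i : Fin 2} {c : ℝ} {p : Poly2}
    (h : restrictLine i c p = 0) : (X i - C c : Poly2) ∣ p := by
  obtain ⟨j, hij⟩ := exists_ne i
  have key : (X i - C c : Poly2) ∣ p - Polynomial.aeval (X j : Poly2) (restrictLine i c p) := by
    clear h
    unfold restrictLine
    induction p using MvPolynomial.induction_on with
    | C a => simp [MvPolynomial.algebraMap_eq]
    | add p q hp hq =>
      simp only [map_add]
      rw [add_sub_add_comm]
      exact dvd_add hp hq
    | mul_X p l hp =>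
      simp only [map_mul, aeval_X]
      by_cases hl : l = i
      · subst hl
        obtain ⟨r, hr⟩ := hp
        refine ⟨r * C c + p, ?_⟩
        rw [sub_eq_iff_eq_add] at hr
        simp only [if_true, Polynomial.aeval_C, MvPolynomial.algebraMap_eq]
        linear_combination C c * hr
      · have : l = j := by omega
        subst this
        simp only [hl, if_false, Polynomial.aeval_X]
        rw [← sub_mul]
        exact hp.mul_right _
  simpa [h] using key

lemma totalDegree_X_sub_C (i : Fin 2) (c : ℝ) : (X i - C c : Poly2).totalDegree = 1 := by
  rw [sub_eq_add_neg, ← C_neg, MvPolynomial.totalDegree_add_eq_left_of_totalDegree_lt] <;>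
    simp

lemma X_sub_C_ne_zero (i : Fin 2) (c : ℝ) : (X i - C c : Poly2) ≠ 0 := by
  intro h
  simpa [h] using totalDegree_X_sub_C i c

lemma DegLT.exists_mul_X_sub_C {m : ℕ} {p : Poly2} (hp : DegLT m p) {i j : Fin 2} (hij : j ≠ i)
    (c : ℝ) {N : ℝ} (hN : N ≠ 0) (S D : Finset ℕ) (hDS : D ⊆ S) (hm : m ≤ S.card + D.card)
    (hS : ∀ s ∈ S, MvPolynomial.eval (fun l => if l = i then c else (s : ℝ) / N) p = 0)
    (hD : ∀ s ∈ D,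
      MvPolynomial.eval (fun l => if l = i then c else (s : ℝ) / N) (pderiv j p) = 0) :
    ∃ r : Poly2, p = (X i - C c) * r ∧ DegLT (m - 1) r := by
  rcases eq_or_ne p 0 with rfl | h0
  · exact ⟨0, by simp, Or.inl rfl⟩
  replace hp := hp.resolve_left h0
  have hinj : Function.Injective (fun s : ℕ => (s : ℝ) / N) := fun s t h => by
    simpa [hN] using h
  have hz : restrictLine i c p = 0 := by
    refine Polynomial.eq_zero_of_double_roots _ (S.image _) (D.image _)
      (Finset.image_subset_image (f := fun s : ℕ => (s : ℝ) / N) hDS) ?_ ?_ ?_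
    · rw [Finset.card_image_of_injective _ hinj, Finset.card_image_of_injective _ hinj]
      exact (natDegree_restrictLine_le i c p).trans_lt (hp.trans_le hm)
    · simpa [eval_restrictLine] using hS
    · simpa [derivative_restrictLine hij, eval_restrictLine] using hD
  obtain ⟨r, rfl⟩ := X_sub_C_dvd_of_restrictLine_eq_zero hz
  refine ⟨r, rfl, ?_⟩
  rcases eq_or_ne r 0 with rfl | hr
  · exact Or.inl rfl
  rw [totalDegree_mul_of_isDomain (X_sub_C_ne_zero i c) hr, totalDegree_X_sub_C] at hp
  exact Or.inr (by omega)

lemma DegLT.exists_mul_vertical {m : ℕ} {p : Poly2} (hp : DegLT m p)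
    (c : ℝ) {N : ℝ} (hN : N ≠ 0) (S D : Finset ℕ) (hDS : D ⊆ S) (hm : m ≤ S.card + D.card)
    (hS : ∀ s ∈ S, ev p c ((s : ℝ) / N) = 0) (hD : ∀ s ∈ D, ev (dY p) c ((s : ℝ) / N) = 0) :
    ∃ r : Poly2, p = (X 0 - C c) * r ∧ DegLT (m - 1) r := by
  have hpt : ∀ t : ℝ, ![c, t] = fun l : Fin 2 => if l = 0 then c else t := fun t => by
    ext l; fin_cases l <;> rfl
  simp only [ev, dY, hpt] at hS hD
  exact hp.exists_mul_X_sub_C (by decide) c hN S D hDS hm hS hD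

lemma DegLT.exists_mul_horizontal {m : ℕ} {p : Poly2} (hp : DegLT m p)
    (c : ℝ) {N : ℝ} (hN : N ≠ 0) (S D : Finset ℕ) (hDS : D ⊆ S) (hm : m ≤ S.card + D.card)
    (hS : ∀ s ∈ S, ev p ((s : ℝ) / N) c = 0) (hD : ∀ s ∈ D, ev (dX p) ((s : ℝ) / N) c = 0) :
    ∃ r : Poly2, p = (X 1 - C c) * r ∧ DegLT (m - 1) r := by
  have hpt : ∀ t : ℝ, ![t, c] = fun l : Fin 2 => if l = 1 then c else t := fun t => by
    ext l; fin_cases l <;> rfl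
  simp only [ev, dX, hpt] at hS hD
  exact hp.exists_mul_X_sub_C (by decide) c hN S D hDS hm hS hD

section evaluation

variable (p q : Poly2) (a b c : ℝ)

@[simp] lemma ev_add : ev (p + q) a b = ev p a b + ev q a b := map_add _ _ _
@[simp] lemma ev_sub : ev (p - q) a b = ev p a b - ev q a b := map_sub _ _ _
@[simp] lemma ev_mul : ev (p * q) a b = ev p a b * ev q a b := map_mul _ _ _
@[simp] lemma ev_C : ev (C c) a b = c := eval_C _
@[simp] lemma ev_one : ev 1 a b = 1 := map_one _
@[simp] lemma ev_zero : ev 0 a b = 0 := map_zero _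
@[simp] lemma ev_X_zero : ev (X 0) a b = a := eval_X _
@[simp] lemma ev_X_one : ev (X 1) a b = b := eval_X _
@[simp] lemma dX_add : dX (p + q) = dX p + dX q := map_add _ _ _
@[simp] lemma dY_add : dY (p + q) = dY p + dY q := map_add _ _ _
@[simp] lemma dX_sub : dX (p - q) = dX p - dX q := map_sub _ _ _
@[simp] lemma dY_sub : dY (p - q) = dY p - dY q := map_sub _ _ _
@[simp] lemma dX_mul : dX (p * q) = dX p * q + p * dX q := pderiv_mul
@[simp] lemma dY_mul : dY (p * q) = dY p * q + p * dY q := pderiv_mul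
@[simp] lemma dX_C : dX (C c) = 0 := pderiv_C
@[simp] lemma dY_C : dY (C c) = 0 := pderiv_C
@[simp] lemma dX_one : dX 1 = 0 := pderiv_one
@[simp] lemma dY_one : dY 1 = 0 := pderiv_one
@[simp] lemma dX_zero : dX 0 = 0 := map_zero _
@[simp] lemma dY_zero : dY 0 = 0 := map_zero _
@[simp] lemma dX_X_zero : dX (X 0) = 1 := pderiv_X_self _
@[simp] lemma dY_X_one : dY (X 1) = 1 := pderiv_X_self _
@[simp] lemma dX_X_one : dX (X 1) = 0 := pderiv_X_of_ne (by decide)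
@[simp] lemma dY_X_zero : dY (X 0) = 0 := pderiv_X_of_ne (by decide)

end evaluation

lemma DegLT.eq_zero_of_triangle {n : ℕ} {q : Poly2} (hq : DegLT n q) {N : ℝ} (hN : N ≠ 0)
    (h : ∀ i j : ℕ, 1 ≤ j → j ≤ i → i ≤ n → ev q ((i : ℝ) / N) ((j : ℝ) / N) = 0) : q = 0 := by
  induction n generalizing q with
  | zero => simpa [DegLT] using hq
  | succ n ih =>
    obtain ⟨r, rfl, hr⟩ := hq.exists_mul_vertical (((n + 1 : ℕ) : ℝ) / N) hN
      (Finset.Icc 1 (n + 1)) ∅ (by simp) (by simp)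
      (fun s hs => by
        rw [Finset.mem_Icc] at hs
        exact h (n + 1) s hs.1 hs.2 le_rfl) (by simp)
    rw [ih hr, mul_zero]
    intro i j hj hji hi
    have := h i j hj hji (by omega)
    rw [ev_mul, mul_eq_zero] at this
    refine this.resolve_left ?_
    simp only [ev_sub, ev_X_zero, ev_C, ← sub_div]
    refine div_ne_zero (sub_ne_zero.2 ?_) hN
    exact_mod_cast (by omega : i ≠ n + 1)

lemma eq_zero_of_dofs {k : ℕ} (hk : 6 ≤ k) {N M : ℝ} (hN : N = k - 2) (hM : M = k - 3)
    {p : Poly2} (hp : p.totalDegree ≤ k)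
    (left : ∀ j : ℕ, j ≤ k - 2 → ev p 0 (j / N) = 0)
    (left_dX : ∀ j : ℕ, j ≤ k - 3 → ev (dX p) 0 (j / M) = 0)
    (left_dY : ev (dY p) 0 0 = 0 ∧ ev (dY p) 0 1 = 0)
    (left_dXY : ev (dX (dY p)) 0 0 = 0 ∧ ev (dX (dY p)) 0 1 = 0)
    (top : ∀ i : ℕ, 1 ≤ i → i ≤ k - 2 → ev p (i / N) 1 = 0)
    (top_dY : ∀ i : ℕ, 1 ≤ i → i ≤ k - 3 → ev (dY p) (i / M) 1 = 0)
    (corner_dX : ev (dX p) 1 1 = 0) (corner_dXY : ev (dX (dY p)) 1 1 = 0)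
    (right : ∀ j : ℕ, 1 ≤ j → j ≤ k - 3 → ev p 1 (j / N) = 0)
    (right_dX : ∀ j : ℕ, 1 ≤ j → j ≤ k - 4 → ev (dX p) 1 (j / M) = 0)
    (bottom : ∀ i : ℕ, 3 ≤ i → i ≤ k - 3 → ev p (i / N) 0 = 0)
    (bottom_dY : ∀ i : ℕ, 3 ≤ i → i ≤ k - 4 → ev (dY p) (i / M) 0 = 0)
    (inner : ∀ i j : ℕ, 1 ≤ j → j ≤ i → i ≤ k - 7 → ev p (i / N) (j / N) = 0) : p = 0 := by
  have hk' : (6 : ℝ) ≤ k := by exact_mod_cast hk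
  have hN0 : N ≠ 0 := by linarith
  have hM0 : M ≠ 0 := by linarith
  have hNk : ((k - 2 : ℕ) : ℝ) / N = 1 := by
    rw [Nat.cast_sub (by omega), hN]; exact div_self (hN ▸ hN0)
  have hMk : ((k - 3 : ℕ) : ℝ) / M = 1 := by
    rw [Nat.cast_sub (by omega), hM]; exact div_self (hM ▸ hM0)
  have nodeN_ne_one : ∀ {j : ℕ}, j ≤ k - 3 → (j : ℝ) / N - 1 ≠ 0 := fun {j} hj => by
    rw [← hNk, ← sub_div]
    refine div_ne_zero (sub_ne_zero.2 ?_) hN0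
    exact_mod_cast (by omega : j ≠ k - 2)
  have nodeM_ne_one : ∀ {j : ℕ}, j ≤ k - 4 → (j : ℝ) / M - 1 ≠ 0 := fun {j} hj => by
    rw [← hMk, ← sub_div]
    refine div_ne_zero (sub_ne_zero.2 ?_) hM0
    exact_mod_cast (by omega : j ≠ k - 3)
  have hpk : DegLT (k + 1) p := Or.inr (by omega)
  -- the left edge
  obtain ⟨p, rfl, hp1⟩ := hpk.exists_mul_vertical 0 hN0 (Finset.range (k - 1)) {0, k - 2}
    (by intro s; simp; omega)
    (by rw [Finset.card_pair (by omega), Finset.card_range]; omega)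
    (fun s hs => left s (by rw [Finset.mem_range] at hs; omega))
    (by simpa [hNk] using left_dY)
  simp at left_dX left_dXY
  obtain ⟨p, rfl, hp2⟩ := hp1.exists_mul_vertical 0 hM0 (Finset.range (k - 2)) {0, k - 3}
    (by intro s; simp; omega)
    (by rw [Finset.card_pair (by omega), Finset.card_range]; omega)
    (fun s hs => left_dX s (by rw [Finset.mem_range] at hs; omega))
    (by simpa [hMk] using left_dXY)
  clear left left_dX left_dY left_dXY hp1 hpk hp
  -- the top edge
  simp at top corner_dX
  have top_zero : ∀ i : ℕ, 1 ≤ i → i ≤ k - 2 → ev p (i / N) 1 = 0 := fun i h1 h2 => by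
    have hi : i ≠ 0 := by omega
    simpa [hN0, hi] using top i h1 h2
  have corner : ev p 1 1 = 0 := by
    simpa [hNk] using top_zero (k - 2) (by omega) le_rfl
  obtain ⟨p, rfl, hp3⟩ := hp2.exists_mul_horizontal 1 hN0 (Finset.Icc 1 (k - 2)) {k - 2}
    (by intro s; simp; omega)
    (by rw [Finset.card_singleton, Nat.card_Icc]; omega)
    (fun s hs => by rw [Finset.mem_Icc] at hs; exact top_zero s hs.1 hs.2)
    (by simpa [hNk, corner] using corner_dX)
  clear top top_zero corner corner_dX hp2
  simp at top_dY corner_dXY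
  have top_zero : ∀ i : ℕ, 1 ≤ i → i ≤ k - 3 → ev p (i / M) 1 = 0 := fun i h1 h2 => by
    have hi : i ≠ 0 := by omega
    simpa [hM0, hi] using top_dY i h1 h2
  have corner : ev p 1 1 = 0 := by
    simpa [hMk] using top_zero (k - 3) (by omega) le_rfl
  obtain ⟨p, rfl, hp4⟩ := hp3.exists_mul_horizontal 1 hM0 (Finset.Icc 1 (k - 3)) {k - 3}
    (by intro s; simp; omega)
    (by rw [Finset.card_singleton, Nat.card_Icc]; omega)
    (fun s hs => by rw [Finset.mem_Icc] at hs; exact top_zero s hs.1 hs.2)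
    (by simpa [hMk, corner] using corner_dXY)
  clear top_zero corner top_dY corner_dXY hp3
  -- the right edge
  obtain ⟨p, rfl, hp5⟩ := hp4.exists_mul_vertical 1 hN0 (Finset.Icc 1 (k - 3)) ∅ (by simp)
    (by rw [Finset.card_empty, Nat.card_Icc]; omega)
    (fun s hs => by
      rw [Finset.mem_Icc] at hs
      simpa [nodeN_ne_one hs.2] using right s hs.1 hs.2) (by simp)
  clear right hp4
  obtain ⟨p, rfl, hp6⟩ := hp5.exists_mul_vertical 1 hM0 (Finset.Icc 1 (k - 4)) ∅ (by simp)
    (by rw [Finset.card_empty, Nat.card_Icc]; omega)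
    (fun s hs => by
      rw [Finset.mem_Icc] at hs
      simpa [nodeM_ne_one hs.2] using right_dX s hs.1 hs.2) (by simp)
  clear right_dX hp5
  -- the bottom edge
  obtain ⟨p, rfl, hp7⟩ := hp6.exists_mul_horizontal 0 hN0 (Finset.Icc 3 (k - 3)) ∅ (by simp)
    (by rw [Finset.card_empty, Nat.card_Icc]; omega)
    (fun s hs => by
      rw [Finset.mem_Icc] at hs
      have hs0 : s ≠ 0 := by omega
      simpa [nodeN_ne_one hs.2, hN0, hs0] using bottom s hs.1 hs.2) (by simp)
  clear bottom hp6
  obtain ⟨p, rfl, hp8⟩ := hp7.exists_mul_horizontal 0 hM0 (Finset.Icc 3 (k - 4)) ∅ (by simp)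
    (by rw [Finset.card_empty, Nat.card_Icc]; omega)
    (fun s hs => by
      rw [Finset.mem_Icc] at hs
      have hs0 : s ≠ 0 := by omega
      simpa [nodeM_ne_one hs.2, hM0, hs0] using bottom_dY s hs.1 hs.2) (by simp)
  clear bottom_dY hp7
  have hp9 : DegLT (k - 7) p := by
    convert hp8 using 1
    omega
  rw [hp9.eq_zero_of_triangle hN0]
  · simp
  · intro i j hj hji hi
    have hi0 : i ≠ 0 := by omega
    have hj0 : j ≠ 0 := by omega
    simpa [hN0, nodeN_ne_one (by omega : i ≤ k - 3), nodeN_ne_one (by omega : j ≤ k - 3),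
      hi0, hj0] using inner i j hj hji hi

lemma dof_injective {T T' : Fin 4 × ℝ × ℝ} (h : dof T = dof T') : T = T' := by
  obtain ⟨τ, a, b⟩ := T
  obtain ⟨τ', a', b'⟩ := T'
  have h1 := congrFun h 1
  have h2 := congrFun h (X 0)
  have h3 := congrFun h (X 1)
  have h4 := congrFun h (X 0 * X 0)
  have h5 := congrFun h (X 0 * X 1)
  have h6 := congrFun h (X 1 * X 1)
  have h7 := congrFun h (X 0 * X 0 * X 1)
  have h8 := congrFun h (X 0 * X 1 * X 1)
  fin_cases τ <;> fin_cases τ' <;> simp [dof] at h1 h2 h3 h4 h5 h6 h7 h8 ⊢ <;>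
    constructor <;> linarith

lemma dof_add (T : Fin 4 × ℝ × ℝ) (p q : Poly2) : dof T (p + q) = dof T p + dof T q := by
  obtain ⟨τ, a, b⟩ := T
  fin_cases τ <;> simp [dof]

lemma dof_smul (T : Fin 4 × ℝ × ℝ) (c : ℝ) (p : Poly2) : dof T (c • p) = c * dof T p := by
  obtain ⟨τ, a, b⟩ := T
  rw [smul_eq_C_mul]
  fin_cases τ <;> simp [dof]

lemma dof_zero (T : Fin 4 × ℝ × ℝ) : dof T 0 = 0 := by
  simpa using dof_smul T 0 0

lemma dof_sum_smul {ι : Type*} (T : Fin 4 × ℝ × ℝ) (s : Finset ι) (c : ι → ℝ) (b : ι → Poly2) :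
    dof T (∑ i ∈ s, c i • b i) = ∑ i ∈ s, c i * dof T (b i) := by
  classical
  induction s using Finset.induction_on with
  | empty => simp [dof_zero]
  | insert i s hi ih => rw [Finset.sum_insert hi, Finset.sum_insert hi, dof_add, dof_smul, ih]

/-- unisolvence of the degrees of freedom for the bubble-enriched
`C¹`-`P_k` element `V_k(T) = P_k + span{b₁,…,b₈}`, `k ≥ 6`. -/
theorem stmt_2
    (k : ℕ) (hk : 6 ≤ k)
    (b : Fin 8 → Poly2)
    (hW : ∀ i, BellSpace k (b i))
    (hb1 : IsDualTo k (fun v => ev v (1 / ((k : ℝ) - 2)) 0) (b 0))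
    (hb2 : IsDualTo k (fun v => ev v (2 / ((k : ℝ) - 2)) 0) (b 1))
    (hb3 : IsDualTo k (fun v => ev (dY v) (1 / ((k : ℝ) - 3)) 0) (b 2))
    (hb4 : IsDualTo k (fun v => ev (dY v) (2 / ((k : ℝ) - 3)) 0) (b 3))
    (hb5 : IsDualTo k (fun v => ev v 1 0) (b 4))
    (hb6 : IsDualTo k (fun v => ev (dX v) 1 0) (b 5))
    (hb7 : IsDualTo k (fun v => ev (dY v) 1 0) (b 6))
    (hb8 : IsDualTo k (fun v => ev (dX (dY v)) 1 0) (b 7))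
    (p : Poly2) (hp : p.totalDegree ≤ k) (c : Fin 8 → ℝ)
    (v : Poly2) (hv : v = p + ∑ i, c i • b i)
    (hvert : ∀ z ∈ ({(0, 0), (1, 0), (1, 1), (0, 1)} : Set (ℝ × ℝ)),
      ev v z.1 z.2 = 0 ∧ ev (dX v) z.1 z.2 = 0 ∧ ev (dY v) z.1 z.2 = 0 ∧
        ev (dX (dY v)) z.1 z.2 = 0)
    (hedge : ∀ j : ℕ, 1 ≤ j → j ≤ k - 3 →
      ev v ((j : ℝ) / ((k : ℝ) - 2)) 0 = 0 ∧ ev v ((j : ℝ) / ((k : ℝ) - 2)) 1 = 0 ∧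
      ev v 0 ((j : ℝ) / ((k : ℝ) - 2)) = 0 ∧ ev v 1 ((j : ℝ) / ((k : ℝ) - 2)) = 0)
    (hnormal : ∀ j : ℕ, 1 ≤ j → j ≤ k - 4 →
      ev (dY v) ((j : ℝ) / ((k : ℝ) - 3)) 0 = 0 ∧ ev (dY v) ((j : ℝ) / ((k : ℝ) - 3)) 1 = 0 ∧
      ev (dX v) 0 ((j : ℝ) / ((k : ℝ) - 3)) = 0 ∧ ev (dX v) 1 ((j : ℝ) / ((k : ℝ) - 3)) = 0)
    (hint : ∀ i j : ℕ, 1 ≤ j → j ≤ i → i ≤ k - 7 →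
      ev v ((i : ℝ) / ((k : ℝ) - 2)) ((j : ℝ) / ((k : ℝ) - 2)) = 0) :
    p = 0 ∧ ∀ i, c i = 0 := by
  have hk' : (6 : ℝ) ≤ k := by exact_mod_cast hk
  obtain ⟨N, hN⟩ : ∃ N : ℝ, N = k - 2 := ⟨_, rfl⟩
  obtain ⟨M, hM⟩ : ∃ M : ℝ, M = k - 3 := ⟨_, rfl⟩
  have hN4 : 4 ≤ N := by linarith
  have hM3 : 3 ≤ M := by linarith
  have hNk : ((k - 2 : ℕ) : ℝ) / N = 1 := by
    rw [Nat.cast_sub (by omega), hN]; exact div_self (by push_cast; linarith)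
  have hMk : ((k - 3 : ℕ) : ℝ) / M = 1 := by
    rw [Nat.cast_sub (by omega), hM]; exact div_self (by push_cast; linarith)
  -- the functionals to which the `b i` are dual
  let d : Fin 8 → Fin 4 × ℝ × ℝ := ![(0, 1 / N, 0), (0, 2 / N, 0), (2, 1 / M, 0), (2, 2 / M, 0),
    (0, 1, 0), (1, 1, 0), (2, 1, 0), (3, 1, 0)]
  have hdual : ∀ i, IsDualTo k (dof (d i)) (b i) := by
    rw [← hN] at hb1 hb2
    rw [← hM] at hb3 hb4
    intro i
    fin_cases i
    exacts [hb1, hb2, hb3, hb4, hb5, hb6, hb7, hb8]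
  have hdinj : Function.Injective d := by
    have h1 : (1 : ℝ) / N ≠ 2 / N := fun h => by field_simp at h; norm_num at h
    have h2 : (1 : ℝ) / M ≠ 2 / M := fun h => by field_simp at h; norm_num at h
    have h3 : (1 : ℝ) / N ≠ 1 := fun h => by field_simp at h; linarith
    have h4 : (1 : ℝ) / M ≠ 1 := fun h => by field_simp at h; linarith
    have h5 : (2 : ℝ) / N ≠ 1 := fun h => by field_simp at h; linarith
    have h6 : (2 : ℝ) / M ≠ 1 := fun h => by field_simp at h; linarith
    intro i j h
    fin_cases i <;> fin_cases j <;> first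
      | rfl
      | (simp only [d, Fin.reduceFinMk, Matrix.cons_val, Prod.mk.injEq] at h
         first
          | exact absurd h.1 (by decide)
          | exact absurd h.2.1 ‹_›
          | exact absurd h.2.1.symm ‹_›)
  have memV : ∀ i j : ℕ, i ≤ k - 2 → j ≤ k - 2 → dof (0, i / N, j / N) ∈ BellDofs k :=
    fun i j hi hj => Or.inl ⟨i, j, hi, hj, by rw [← hN]; rfl⟩
  have memX : ∀ i j : ℕ, i ≤ 1 → j ≤ k - 3 → dof (1, i, j / M) ∈ BellDofs k :=
    fun i j hi hj => Or.inr (Or.inl ⟨i, j, hi, hj, by rw [← hM]; rfl⟩)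
  have memY : ∀ i j : ℕ, i ≤ k - 3 → j ≤ 1 → dof (2, i / M, j) ∈ BellDofs k :=
    fun i j hi hj => Or.inr (Or.inr (Or.inl ⟨i, j, hi, hj, by rw [← hM]; rfl⟩))
  have memXY : ∀ i j : ℕ, i ≤ 1 → j ≤ 1 → dof (3, i, j) ∈ BellDofs k :=
    fun i j hi hj => Or.inr (Or.inr (Or.inr ⟨i, j, hi, hj, rfl⟩))
  have hdmem : ∀ i, dof (d i) ∈ BellDofs k := by
    intro i
    fin_cases i
    · simpa [d] using memV 1 0 (by omega) (by omega)
    · simpa [d] using memV 2 0 (by omega) (by omega)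
    · simpa [d] using memY 1 0 (by omega) (by omega)
    · simpa [d] using memY 2 0 (by omega) (by omega)
    · simpa [d, hNk] using memV (k - 2) 0 (by omega) (by omega)
    · simpa [d] using memX 1 0 (by omega) (by omega)
    · simpa [d, hMk] using memY (k - 3) 0 (by omega) (by omega)
    · simpa [d] using memXY 1 0 (by omega) (by omega)
  -- the vanishing of the Bell functionals on the boundary
  obtain ⟨v00, v00X, v00Y, v00XY⟩ := hvert (0, 0) (by simp)
  obtain ⟨v10, v10X, v10Y, v10XY⟩ := hvert (1, 0) (by simp)
  obtain ⟨v11, v11X, v11Y, v11XY⟩ := hvert (1, 1) (by simp)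
  obtain ⟨v01, v01X, v01Y, v01XY⟩ := hvert (0, 1) (by simp)
  rw [← hN] at hedge hint
  rw [← hM] at hnormal
  have hdv : ∀ i, dof (d i) v = 0 := by
    have e1 := (hedge 1 le_rfl (by omega)).1
    have e2 := (hedge 2 (by omega) (by omega)).1
    have n1 := (hnormal 1 le_rfl (by omega)).1
    have n2 := (hnormal 2 (by omega) (by omega)).1
    simp only [Nat.cast_one, Nat.cast_ofNat] at e1 e2 n1 n2
    intro i
    fin_cases i
    exacts [e1, e2, n1, n2, v10, v10X, v10Y, v10XY]
  have hexp : ∀ T, dof T v = dof T p + ∑ i, c i * dof T (b i) := fun T => by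
    rw [hv, dof_add, dof_sum_smul]
  have transfer : ∀ T, dof T ∈ BellDofs k → T ∉ Set.range d → dof T v = 0 → dof T p = 0 := by
    intro T hT hd h0
    rw [hexp, Finset.sum_eq_zero, add_zero] at h0
    · exact h0
    · intro i _
      rw [(hdual i).2 _ hT fun h => hd ⟨i, (dof_injective h).symm⟩, mul_zero]
  have range_snd : ∀ {τ : Fin 4} {x y : ℝ}, x = 0 ∨ y ≠ 0 → (τ, x, y) ∉ Set.range d := by
    rintro τ x y h ⟨i, hi⟩
    have hx : (d i).2.1 ≠ 0 := by fin_cases i <;> simp [d] <;> linarith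
    have hy : (d i).2.2 = 0 := by fin_cases i <;> rfl
    rw [hi] at hx hy
    exact h.elim hx fun h => h hy
  have range_bottom : ∀ {K : ℝ} {i : ℕ} {τ : Fin 4}, τ = 0 ∧ K = N ∧ i ≤ k - 3 ∨
      τ = 2 ∧ K = M ∧ i ≤ k - 4 → 3 ≤ i → (τ, (i : ℝ) / K, (0 : ℝ)) ∉ Set.range d := by
    rintro K i τ h h3 ⟨l, hl⟩
    have h3' : (3 : ℝ) ≤ i := by exact_mod_cast h3
    rcases h with ⟨rfl, rfl, hi⟩ | ⟨rfl, rfl, hi⟩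
    · have hi' : (i : ℝ) < K := by
        rw [hN, lt_sub_iff_add_lt]; exact_mod_cast (by omega : i + 2 < k)
      fin_cases l <;> simp [d] at hl <;> field_simp at hl <;> linarith
    · have hi' : (i : ℝ) < K := by
        rw [hM, lt_sub_iff_add_lt]; exact_mod_cast (by omega : i + 3 < k)
      fin_cases l <;> simp [d] at hl <;> field_simp at hl <;> linarith
  have node_ne_zero : ∀ {K : ℝ} {j : ℕ}, 3 ≤ K → 1 ≤ j → (j : ℝ) / K ≠ 0 := fun hK hj =>
    div_ne_zero (Nat.cast_ne_zero.2 (by omega)) (by linarith)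
  have hN3 : 3 ≤ N := by linarith
  have hp0 : p = 0 := by
    refine eq_zero_of_dofs hk hN hM hp ?_ ?_ ⟨?_, ?_⟩ ⟨?_, ?_⟩ ?_ ?_ ?_ ?_ ?_ ?_ ?_ ?_ ?_
    · intro j hj
      refine transfer (0, 0, j / N) (by simpa using memV 0 j (by omega) hj)
        (range_snd (.inl rfl)) ?_
      rcases Nat.eq_zero_or_pos j with rfl | h0
      · simpa [dof] using v00
      rcases hj.eq_or_lt with rfl | h1
      · simpa [dof, hNk] using v01
      · exact (hedge j h0 (by omega)).2.2.1
    · intro j hj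
      refine transfer (1, 0, j / M) (by simpa using memX 0 j (by omega) hj)
        (range_snd (.inl rfl)) ?_
      rcases Nat.eq_zero_or_pos j with rfl | h0
      · simpa [dof] using v00X
      rcases hj.eq_or_lt with rfl | h1
      · simpa [dof, hMk] using v01X
      · exact (hnormal j h0 (by omega)).2.2.1
    · exact transfer (2, 0, 0) (by simpa using memY 0 0 (by omega) (by omega))
        (range_snd (.inl rfl)) v00Y
    · exact transfer (2, 0, 1) (by simpa using memY 0 1 (by omega) (by omega))
        (range_snd (.inl rfl)) v01Y
    · exact transfer (3, 0, 0) (by simpa using memXY 0 0 (by omega) (by omega))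
        (range_snd (.inl rfl)) v00XY
    · exact transfer (3, 0, 1) (by simpa using memXY 0 1 (by omega) (by omega))
        (range_snd (.inl rfl)) v01XY
    · intro i h0 hi
      refine transfer (0, i / N, 1) (by simpa [hNk] using memV i (k - 2) hi le_rfl)
        (range_snd (.inr one_ne_zero)) ?_
      rcases hi.eq_or_lt with rfl | h1
      · simpa [dof, hNk] using v11
      · exact (hedge i h0 (by omega)).2.1
    · intro i h0 hi
      refine transfer (2, i / M, 1) (by simpa using memY i 1 hi le_rfl)
        (range_snd (.inr one_ne_zero)) ?_
      rcases hi.eq_or_lt with rfl | h1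
      · simpa [dof, hMk] using v11Y
      · exact (hnormal i h0 (by omega)).2.1
    · exact transfer (1, 1, 1) (by simpa [hMk] using memX 1 (k - 3) le_rfl le_rfl)
        (range_snd (.inr one_ne_zero)) v11X
    · exact transfer (3, 1, 1) (by simpa using memXY 1 1 le_rfl le_rfl)
        (range_snd (.inr one_ne_zero)) v11XY
    · intro j h0 hj
      exact transfer (0, 1, j / N) (by simpa [hNk] using memV (k - 2) j le_rfl (by omega))
        (range_snd (.inr (node_ne_zero hN3 h0))) (hedge j h0 hj).2.2.2
    · intro j h0 hj
      exact transfer (1, 1, j / M) (by simpa using memX 1 j le_rfl (by omega))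
        (range_snd (.inr (node_ne_zero hM3 h0))) (hnormal j h0 hj).2.2.2
    · intro i h3 hi
      exact transfer (0, i / N, 0) (by simpa using memV i 0 (by omega) (by omega))
        (range_bottom (.inl ⟨rfl, rfl, hi⟩) h3) (hedge i (by omega) hi).1
    · intro i h3 hi
      exact transfer (2, i / M, 0) (by simpa using memY i 0 (by omega) (by omega))
        (range_bottom (.inr ⟨rfl, rfl, hi⟩) h3) (hnormal i (by omega) hi).1
    · intro i j hj hji hi
      exact transfer (0, i / N, j / N) (memV i j (by omega) (by omega))
        (range_snd (.inr (node_ne_zero hN3 hj))) (hint i j hj hji hi)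
  refine ⟨hp0, fun i => ?_⟩
  have h := hexp (d i)
  rw [hdv, hp0, dof_zero, zero_add, Finset.sum_eq_single i, (hdual i).1, mul_one] at h
  · exact h.symm
  · intro j _ hji
    rw [(hdual j).2 _ (hdmem i) fun h => hji (hdinj (dof_injective h)).symm, mul_zero]
  · simp
end
end

section
/- If p ∈ P_5 satisfies p = ∂_x p = ∂_y p = ∂_{xy} p = 0 at each of the four vertices (0,0), (1,0), (1,1), (0,1) of the unit square, p vanishes at the eight edge points (1/3,0), (2/3,0), (1,1/3), (1,2/3), (1/3,1), (2/3,1), (0,1/3), (0,2/3), and ∂_y p(1/2,0) = ∂_y p(1/2,1) = ∂_x p(0,1/2) = ∂_x p(1,1/2) = 0, then p = 0. -/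
open MvPolynomial

noncomputable section

/-- A bivariate polynomial of total degree at most `n` is the sum of its monomials
`c i j * x ^ i * y ^ j` with `i + j ≤ n`. -/
theorem eq_sum_monomials_of_totalDegree_le {p : Poly2} {n : ℕ} (hp : p.totalDegree ≤ n) :
    p = ∑ i ∈ Finset.range (n + 1), ∑ j ∈ Finset.range (n + 1 - i),
      C (coeff (Finsupp.single 0 i + Finsupp.single 1 j) p) * X 0 ^ i * X 1 ^ j := by
  have hmon (i j : ℕ) (c : ℝ) : (C c * X 0 ^ i * X 1 ^ j : Poly2) =
      monomial (Finsupp.single 0 i + Finsupp.single 1 j) c := by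
    rw [X_pow_eq_monomial, X_pow_eq_monomial, C_mul_monomial, monomial_mul, mul_one, mul_one]
  have hexp (m : Fin 2 →₀ ℕ) : Finsupp.single 0 (m 0) + Finsupp.single 1 (m 1) = m := by
    ext k; fin_cases k <;> simp
  have hinj (m : Fin 2 →₀ ℕ) (i j : ℕ) :
      Finsupp.single 0 i + Finsupp.single 1 j = m ↔ i = m 0 ∧ j = m 1 := by
    refine ⟨?_, fun ⟨hi, hj⟩ => by rw [hi, hj, hexp]⟩
    rintro rfl
    simp
  ext m
  simp only [hmon, coeff_sum, coeff_monomial, hinj, ite_and]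
  simp only [Finset.sum_ite_irrel, Finset.sum_const_zero, Finset.sum_ite_eq', Finset.mem_range,
    hexp]
  split_ifs with h0 h1
  · rfl
  all_goals
    apply coeff_eq_zero_of_totalDegree_lt
    rw [← Finsupp.degree_apply, Finsupp.degree_eq_sum, Fin.sum_univ_two]
    omega

/-- A quintic with double zeros at `0` and `1` and further zeros at `1 / 3` and `2 / 3` is zero. -/
theorem quintic_coeffs_eq_zero {a₀ a₁ a₂ a₃ a₄ a₅ : ℝ} (h0 : a₀ = 0) (hd0 : a₁ = 0)
    (h1 : a₀ + a₁ + a₂ + a₃ + a₄ + a₅ = 0) (hd1 : a₁ + a₂ * 2 + a₃ * 3 + a₄ * 4 + a₅ * 5 = 0)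
    (hl : a₀ + a₁ * (1 / 3) + a₂ * (1 / 9) + a₃ * (1 / 27) + a₄ * (1 / 81) + a₅ * (1 / 243) = 0)
    (hr : a₀ + a₁ * (2 / 3) + a₂ * (4 / 9) + a₃ * (8 / 27) + a₄ * (16 / 81) +
      a₅ * (32 / 243) = 0) :
    a₀ = 0 ∧ a₁ = 0 ∧ a₂ = 0 ∧ a₃ = 0 ∧ a₄ = 0 ∧ a₅ = 0 := by
  refine ⟨h0, hd0, ?_, ?_, ?_, ?_⟩ <;> linarith

/-- a `P₅` polynomial with vanishing value and first/mixed derivatives at the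
four vertices, vanishing values at eight edge points, and vanishing normal derivatives at
the four edge midpoints, is zero. -/
theorem stmt_4
    (p : Poly2) (hp : p.totalDegree ≤ 5)
    (hvert : ∀ z ∈ ({(0, 0), (1, 0), (1, 1), (0, 1)} : Set (ℝ × ℝ)),
      ev p z.1 z.2 = 0 ∧ ev (dX p) z.1 z.2 = 0 ∧ ev (dY p) z.1 z.2 = 0 ∧
        ev (dX (dY p)) z.1 z.2 = 0)
    (hedge : ∀ z ∈ ({(1 / 3, 0), (2 / 3, 0), (1, 1 / 3), (1, 2 / 3),
        (1 / 3, 1), (2 / 3, 1), (0, 1 / 3), (0, 2 / 3)} : Set (ℝ × ℝ)),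
      ev p z.1 z.2 = 0)
    (hny1 : ev (dY p) (1 / 2) 0 = 0) (hny2 : ev (dY p) (1 / 2) 1 = 0)
    (hnx1 : ev (dX p) 0 (1 / 2) = 0) (hnx2 : ev (dX p) 1 (1 / 2) = 0) :
    p = 0 := by
  have hsum := eq_sum_monomials_of_totalDegree_le hp
  generalize hc : (fun i j : ℕ => coeff (Finsupp.single 0 i + Finsupp.single 1 j) p) = c at hsum
  replace hsum : p = ∑ i ∈ Finset.range 6, ∑ j ∈ Finset.range (6 - i),
      C (c i j) * X 0 ^ i * X 1 ^ j := by
    subst hc; exact hsum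
  clear hc hp
  simp only [Set.mem_insert_iff, Set.mem_singleton_iff, forall_eq_or_imp, forall_eq] at hvert hedge
  obtain ⟨⟨v00, x00, y00, -⟩, ⟨v10, x10, y10, -⟩, ⟨v11, x11, y11, -⟩, v01, x01, y01, -⟩ := hvert
  obtain ⟨s1, s2, e1, e2, n1, n2, w1, w2⟩ := hedge
  suffices h : ∀ i < 6, ∀ j < 6 - i, c i j = 0 by
    rw [hsum]
    refine Finset.sum_eq_zero fun i hi => Finset.sum_eq_zero fun j hj => ?_
    rw [h i (Finset.mem_range.1 hi) j (Finset.mem_range.1 hj), C_0, zero_mul, zero_mul]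
  have hv (a b : ℝ) : ev p a b = ∑ i ∈ Finset.range 6, ∑ j ∈ Finset.range (6 - i),
      c i j * a ^ i * b ^ j := by
    simp [hsum, ev]
  have hx (a b : ℝ) : ev (dX p) a b = ∑ i ∈ Finset.range 6, ∑ j ∈ Finset.range (6 - i),
      c i j * (i * a ^ (i - 1)) * b ^ j := by
    simp [hsum, ev, dX, pderiv_X, mul_comm]
  have hy (a b : ℝ) : ev (dY p) a b = ∑ i ∈ Finset.range 6, ∑ j ∈ Finset.range (6 - i),
      c i j * a ^ i * (j * b ^ (j - 1)) := by
    simp [hsum, ev, dY, pderiv_X, mul_comm, mul_assoc, mul_left_comm]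
  clear hsum
  simp only [hv, hx, hy] at *
  clear hv hx hy
  norm_num [Finset.sum_range_succ] at *
  obtain ⟨-, -, b2, b3, b4, b5⟩ := quintic_coeffs_eq_zero v00 x00 v10 x10 s1 s2
  obtain ⟨-, -, l2, l3, l4, l5⟩ := quintic_coeffs_eq_zero v00 y00 v01 y01 w1 w2
  simp only [v00, x00, y00, b2, b3, b4, b5, l2, l3, l4, l5, zero_add, add_zero, zero_mul]
    at v11 x11 y11 x01 y10 e1 e2 n1 n2 hny1 hny2 hnx1 hnx2
  obtain ⟨-, t1, t2, t3, t4, -⟩ := quintic_coeffs_eq_zero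
    (a₀ := 0) (a₁ := c 1 1 + c 1 2 + c 1 3 + c 1 4) (a₂ := c 2 1 + c 2 2 + c 2 3)
    (a₃ := c 3 1 + c 3 2) (a₄ := c 4 1) (a₅ := 0)
    rfl x01 (by linarith only [v11]) (by linarith only [x11]) (by linarith only [n1])
    (by linarith only [n2])
  obtain ⟨-, r1, r2, r3, r4, -⟩ := quintic_coeffs_eq_zero
    (a₀ := 0) (a₁ := c 1 1 + c 2 1 + c 3 1 + c 4 1) (a₂ := c 1 2 + c 2 2 + c 3 2)
    (a₃ := c 1 3 + c 2 3) (a₄ := c 1 4) (a₅ := 0)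
    rfl y10 (by linarith only [v11]) (by linarith only [y11]) (by linarith only [e1])
    (by linarith only [e2])
  intro i hi j hj
  interval_cases i <;> interval_cases j <;> first | assumption |
    linarith only [t1, t2, t3, t4, r1, r2, r3, r4, hny1, hny2, hnx1, hnx2]
end
end

section
/- Let k ≥ 4 and let p ∈ P_k satisfy: p = ∂_x p = ∂_y p = ∂_{xy} p = 0 at the two points (0,0) and (0,1); p(0, j/(k−2)) = 0 for j = 1,…,k−3; and ∂_x p(0, j/(k−3)) = 0 for j = 1,…,k−4. Then x² divides p; that is, p = x²·q for some q ∈ P_{k−2}. -/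
open MvPolynomial

noncomputable section

/-- The restriction of a bivariate polynomial to the line `x = 0`. -/
def edgeTrace : Poly2 →ₐ[ℝ] Polynomial ℝ := aeval ![0, Polynomial.X]

theorem eval_edgeTrace (p : Poly2) (b : ℝ) : (edgeTrace p).eval b = ev p 0 b := by
  induction p using MvPolynomial.induction_on with
  | C a => simp [edgeTrace, ev]
  | add p q hp hq => simp_all [ev]
  | mul_X p i hp => fin_cases i <;> simp_all [ev, edgeTrace]

theorem derivative_edgeTrace (p : Poly2) :
    Polynomial.derivative (edgeTrace p) = edgeTrace (dY p) := by
  induction p using MvPolynomial.induction_on with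
  | C a => simp [edgeTrace, dY]
  | add p q hp hq => simp_all [dY]
  | mul_X p i hp => fin_cases i <;> simp_all [dY, edgeTrace, Derivation.leibniz, pderiv_X]; ring

theorem coeff_edgeTrace (p : Poly2) (n : ℕ) :
    (edgeTrace p).coeff n = p.coeff (Finsupp.single 1 n) := by
  induction p using MvPolynomial.induction_on' with
  | add p q hp hq => simp_all
  | monomial m a =>
    have key : m = Finsupp.single 1 n ↔ m 0 = 0 ∧ n = m 1 := by
      rw [Finsupp.ext_iff, Fin.forall_fin_two]
      simp [eq_comm]
    rw [coeff_monomial, edgeTrace, aeval_monomial, Finsupp.prod_fintype _ _ (by simp)]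
    by_cases h : m 0 = 0 <;>
      simp [key, h, Fin.prod_univ_two, Polynomial.coeff_X_pow]

theorem natDegree_edgeTrace_le (p : Poly2) : (edgeTrace p).natDegree ≤ p.totalDegree := by
  refine Polynomial.natDegree_le_iff_coeff_eq_zero.2 fun n hn => ?_
  rw [coeff_edgeTrace]
  apply coeff_eq_zero_of_totalDegree_lt
  have hn0 : n ≠ 0 := by omega
  simpa [Finsupp.support_single, hn0] using hn

theorem dX_dY_comm (p : Poly2) : dX (dY p) = dY (dX p) := by
  induction p using MvPolynomial.induction_on with
  | C a => simp [dX, dY]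
  | add p q hp hq => simp_all [dX, dY]
  | mul_X p i hp =>
    fin_cases i <;> simp_all [dX, dY, Derivation.leibniz, pderiv_X] <;> ring

theorem totalDegree_dX_le (p : Poly2) : (dX p).totalDegree ≤ p.totalDegree - 1 := by
  refine Finset.sup_le fun m hm => ?_
  have hm' : m + Finsupp.single 0 1 ∈ p.support := by
    rw [mem_support_iff, dX, coeff_pderiv] at hm
    exact mem_support_iff.2 (left_ne_zero_of_mul hm)
  have := le_totalDegree hm'
  rw [Finsupp.sum_add_index' (by simp) (by simp), Finsupp.sum_single_index rfl] at this
  exact Nat.le_sub_of_add_le this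

/-- A univariate polynomial of degree at most `N + 2` vanishes if it has double roots at `0`
and `1` and vanishes at the interior equispaced points `j / N`. -/
theorem eq_zero_of_double_roots_of_equispaced_roots {f : Polynomial ℝ} {N : ℕ} (hN : 1 ≤ N)
    (hdeg : f.natDegree ≤ N + 2)
    (h0 : f.eval 0 = 0) (h0' : f.derivative.eval 0 = 0)
    (h1 : f.eval 1 = 0) (h1' : f.derivative.eval 1 = 0)
    (hint : ∀ j : ℕ, 1 ≤ j → j ≤ N - 1 → f.eval ((j : ℝ) / N) = 0) : f = 0 := by
  by_contra hf
  have hN' : (N : ℝ) ≠ 0 := by positivity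
  set s : Finset ℝ := (Finset.Icc 1 (N - 1)).image fun j : ℕ => (j : ℝ) / N with hs
  have hcard : s.card = N - 1 := by
    rw [hs, Finset.card_image_of_injective, Nat.card_Icc]
    · omega
    · intro a b hab
      simpa [div_left_inj' hN'] using hab
  have hs0 : (0 : ℝ) ∉ s := by
    simp only [hs, Finset.mem_image, Finset.mem_Icc, div_eq_zero_iff, Nat.cast_eq_zero]
    rintro ⟨j, hj, h | h⟩ <;> omega
  have hs1 : (1 : ℝ) ∉ s := by
    simp only [hs, Finset.mem_image, Finset.mem_Icc, div_eq_one_iff_eq hN', Nat.cast_inj]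
    rintro ⟨j, hj, h⟩
    omega
  have hm0 : 1 < f.rootMultiplicity 0 :=
    (Polynomial.one_lt_rootMultiplicity_iff_isRoot hf).2 ⟨h0, h0'⟩
  have hm1 : 1 < f.rootMultiplicity 1 :=
    (Polynomial.one_lt_rootMultiplicity_iff_isRoot hf).2 ⟨h1, h1'⟩
  have hle : Multiset.replicate 2 0 + Multiset.replicate 2 1 + s.val ≤ f.roots := by
    rw [Multiset.le_iff_count]
    intro a
    rw [Polynomial.count_roots, Multiset.count_add, Multiset.count_add,
      Multiset.count_replicate, Multiset.count_replicate]
    by_cases has : a ∈ s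
    · have ha0 : (0 : ℝ) ≠ a := fun h => hs0 (h ▸ has)
      have ha1 : (1 : ℝ) ≠ a := fun h => hs1 (h ▸ has)
      rw [if_neg ha0, if_neg ha1, Multiset.count_eq_one_of_mem s.nodup has, zero_add, zero_add,
        Nat.one_le_iff_ne_zero, ← Nat.pos_iff_ne_zero, Polynomial.rootMultiplicity_pos hf]
      obtain ⟨j, hj, rfl⟩ := Finset.mem_image.1 has
      exact hint j (Finset.mem_Icc.1 hj).1 (Finset.mem_Icc.1 hj).2
    · rw [Multiset.count_eq_zero_of_notMem (by simpa using has)]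
      by_cases ha0 : (0 : ℝ) = a
      · subst ha0; simpa using Nat.succ_le_of_lt hm0
      · by_cases ha1 : (1 : ℝ) = a
        · subst ha1; simpa using Nat.succ_le_of_lt hm1
        · simp [ha0, ha1]
  have := (Multiset.card_le_card hle).trans f.card_roots'
  simp [hcard] at this
  omega

theorem X_sq_dvd_of_edgeTrace_eq_zero {p : Poly2} (h : edgeTrace p = 0)
    (h' : edgeTrace (dX p) = 0) : (X 0 : Poly2) ^ 2 ∣ p := by
  rw [X_pow_eq_monomial, monomial_one_dvd_iff_modMonomial_eq_zero]
  ext m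
  rw [coeff_zero]
  by_cases hm : Finsupp.single 0 2 ≤ m
  · exact coeff_modMonomial_of_le _ hm
  rw [coeff_modMonomial_of_not_le _ hm]
  have hm2 : m 0 < 2 := by simpa using hm
  have hm01 : m = Finsupp.single 1 (m 1) + Finsupp.single 0 (m 0) := by
    ext i; fin_cases i <;> simp
  rw [hm01]
  obtain h0 | h1 : m 0 = 0 ∨ m 0 = 1 := by omega
  · rw [h0, Finsupp.single_zero, add_zero, ← coeff_edgeTrace, h, Polynomial.coeff_zero]
  · have := coeff_edgeTrace (dX p) (m 1)
    rw [h', dX, coeff_pderiv] at this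
    simpa [h1] using this.symm

/-- if all the degrees of freedom of a `P_k` polynomial (`k ≥ 4`) associated
with the edge `x = 0` vanish, then `x²` divides `p`, with quotient in `P_{k-2}`. -/
theorem stmt_6
    (k : ℕ) (hk : 4 ≤ k)
    (p : Poly2) (hp : p.totalDegree ≤ k)
    (hvert : ∀ z ∈ ({(0, 0), (0, 1)} : Set (ℝ × ℝ)),
      ev p z.1 z.2 = 0 ∧ ev (dX p) z.1 z.2 = 0 ∧ ev (dY p) z.1 z.2 = 0 ∧
        ev (dX (dY p)) z.1 z.2 = 0)
    (hedge : ∀ j : ℕ, 1 ≤ j → j ≤ k - 3 → ev p 0 ((j : ℝ) / ((k : ℝ) - 2)) = 0)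
    (hnormal : ∀ j : ℕ, 1 ≤ j → j ≤ k - 4 → ev (dX p) 0 ((j : ℝ) / ((k : ℝ) - 3)) = 0) :
    ∃ q : Poly2, q.totalDegree ≤ k - 2 ∧ p = (MvPolynomial.X 0) ^ 2 * q := by
  obtain ⟨h0, hx0, hy0, hxy0⟩ := hvert (0, 0) (by simp)
  obtain ⟨h1, hx1, hy1, hxy1⟩ := hvert (0, 1) (by simp)
  have htrace : edgeTrace p = 0 := by
    refine eq_zero_of_double_roots_of_equispaced_roots (N := k - 2) (by omega)
      ((natDegree_edgeTrace_le p).trans (by omega)) ?_ ?_ ?_ ?_ fun j hj hj' => ?_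
    all_goals simp only [derivative_edgeTrace, eval_edgeTrace]
    · exact h0
    · exact hy0
    · exact h1
    · exact hy1
    · rw [Nat.cast_sub (by omega)]
      exact hedge j hj (by omega)
  have htrace' : edgeTrace (dX p) = 0 := by
    refine eq_zero_of_double_roots_of_equispaced_roots (N := k - 3) (by omega)
      ((natDegree_edgeTrace_le _).trans ((totalDegree_dX_le p).trans (by omega)))
      ?_ ?_ ?_ ?_ fun j hj hj' => ?_
    all_goals simp only [derivative_edgeTrace, eval_edgeTrace, ← dX_dY_comm]
    · exact hx0
    · exact hxy0
    · exact hx1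
    · exact hxy1
    · rw [Nat.cast_sub (by omega)]
      exact hnormal j hj (by omega)
  obtain ⟨q, rfl⟩ := X_sq_dvd_of_edgeTrace_eq_zero htrace htrace'
  refine ⟨q, ?_, rfl⟩
  rcases eq_or_ne q 0 with rfl | hq
  · simp
  rw [totalDegree_mul_of_isDomain (pow_ne_zero 2 (X_ne_zero 0)) hq, totalDegree_X_pow] at hp
  omega
end
end

section
/- Let k ≥ 4 and let p ∈ P_k satisfy: p = ∂_x p = ∂_y p = ∂_{xy} p = 0 at each of the four vertices (0,0), (1,0), (1,1), (0,1) of the unit square; p(j/(k−2),0) = p(j/(k−2),1) = p(0,j/(k−2)) = p(1,j/(k−2)) = 0 for j = 1,…,k−3; and ∂_y p(j/(k−3),0) = ∂_y p(j/(k−3),1) = ∂_x p(0,j/(k−3)) = ∂_x p(1,j/(k−3)) = 0 for j = 1,…,k−4. Then p = x²(1−x)²y²(1−y)²·q for some q ∈ P_{k−8}; in particular, p = 0 whenever k ≤ 7. -/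
open MvPolynomial

noncomputable section

/-- A polynomial of degree at most `m + 2` with double zeros at `0` and `1` and zeros at the interior
nodes `j / m` vanishes. -/
theorem Polynomial.eq_zero_of_hermite_nodes {f : Polynomial ℝ} {m : ℕ}
    (hdeg : f.natDegree ≤ m + 2)
    (h0 : f.eval 0 = 0) (h0' : f.derivative.eval 0 = 0)
    (h1 : f.eval 1 = 0) (h1' : f.derivative.eval 1 = 0)
    (hnodes : ∀ j : ℕ, 0 < j → j < m → f.eval ((j : ℝ) / m) = 0) : f = 0 := by
  by_contra hf
  have key : ∀ a : ℝ, f.eval a = 0 → f.derivative.eval a = 0 →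
      (Polynomial.X - Polynomial.C a) ^ 2 ∣ f := fun a ha ha' =>
    (Polynomial.le_rootMultiplicity_iff hf).1
      ((Polynomial.one_lt_rootMultiplicity_iff_isRoot hf).2 ⟨ha, ha'⟩)
  have hcop : IsCoprime ((Polynomial.X - Polynomial.C (0 : ℝ)) ^ 2)
      ((Polynomial.X - Polynomial.C (1 : ℝ)) ^ 2) :=
    (Polynomial.isCoprime_X_sub_C_of_isUnit_sub (by simp)).pow
  obtain ⟨g, rfl⟩ := hcop.mul_dvd (key 0 h0 h0') (key 1 h1 h1')
  have hg : g ≠ 0 := right_ne_zero_of_mul hf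
  rw [Polynomial.natDegree_mul (left_ne_zero_of_mul hf) hg,
    Polynomial.natDegree_mul (left_ne_zero_of_mul (left_ne_zero_of_mul hf))
      (right_ne_zero_of_mul (left_ne_zero_of_mul hf)),
    Polynomial.natDegree_pow, Polynomial.natDegree_pow, Polynomial.natDegree_X_sub_C,
    Polynomial.natDegree_X_sub_C] at hdeg
  have hm : (0 : ℝ) < m := Nat.cast_pos.2 (by omega)
  refine hg (Polynomial.eq_zero_of_natDegree_lt_card_of_eval_eq_zero g
    (f := fun j : Fin (m - 1) => ((j + 1 : ℕ) : ℝ) / m) ?_ ?_ ?_)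
  · intro i j hij
    have : ((i + 1 : ℕ) : ℝ) = ((j + 1 : ℕ) : ℝ) := (div_left_inj' hm.ne').1 hij
    exact Fin.ext (by simpa using this)
  · intro j
    have hlt : ((j + 1 : ℕ) : ℝ) / m < 1 := (div_lt_one hm).2 (Nat.cast_lt.2 (by omega))
    have hpos : 0 < ((j + 1 : ℕ) : ℝ) / m := div_pos (Nat.cast_pos.2 (by omega)) hm
    have := hnodes (j + 1) (by omega) (by omega)
    simpa [hpos.ne', sub_ne_zero.2 hlt.ne, -Nat.cast_add] using this
  · rw [Fintype.card_fin]
    omega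

namespace MvPolynomial

theorem pderiv_comm {σ R : Type*} [CommRing R] (i j : σ) (p : MvPolynomial σ R) :
    pderiv i (pderiv j p) = pderiv j (pderiv i p) := by
  classical
  have h : ⁅pderiv (R := R) i, pderiv (R := R) j⁆ = 0 := by
    refine derivation_ext fun l => ?_
    simp only [Derivation.commutator_apply, pderiv_X, Pi.single_apply, Derivation.zero_apply]
    split_ifs <;> simp
  rw [← sub_eq_zero, ← Derivation.commutator_apply, h, Derivation.zero_apply]

theorem totalDegree_pderiv_le {σ R : Type*} [CommSemiring R] (i : σ) (p : MvPolynomial σ R) :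
    (pderiv i p).totalDegree ≤ p.totalDegree - 1 := by
  classical
  conv_lhs => rw [p.as_sum, map_sum]
  refine totalDegree_finsetSum_le fun s hs => ?_
  rw [pderiv_monomial]
  by_cases hi : s i = 0
  · simp [hi]
  · refine (totalDegree_monomial_le _ _).trans ?_
    have hle : Finsupp.single i 1 ≤ s := by
      rw [Finsupp.single_le_iff]; omega
    have hs' : s.degree ≤ p.totalDegree := le_totalDegree hs
    have hadd : (s - Finsupp.single i 1).degree + 1 = s.degree := by
      conv_rhs => rw [← tsub_add_cancel_of_le hle]
      simp [Finsupp.degree_single]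
    change (s - Finsupp.single i 1).degree ≤ _
    omega

variable {σ : Type*} [DecidableEq σ]

/-- Substitute the constant `c` for the variable `i` and the univariate variable for all others. -/
def restrictLine (i : σ) (c : ℝ) : MvPolynomial σ ℝ →ₐ[ℝ] Polynomial ℝ :=
  aeval fun l => if l = i then Polynomial.C c else Polynomial.X

@[simp] theorem restrictLine_X_self (i : σ) (c : ℝ) :
    restrictLine i c (X i) = Polynomial.C c := by
  simp [restrictLine]

theorem restrictLine_X_of_ne {i j : σ} (h : j ≠ i) (c : ℝ) :
    restrictLine i c (X j) = Polynomial.X := by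
  simp [restrictLine, h]

@[simp] theorem restrictLine_C (i : σ) (c a : ℝ) :
    restrictLine i c (C a) = Polynomial.C a := by
  simp [restrictLine]

theorem natDegree_restrictLine_le (i : σ) (c : ℝ) (p : MvPolynomial σ ℝ) :
    (restrictLine i c p).natDegree ≤ p.totalDegree := by
  have := aeval_natDegree_le (n := 1) p le_rfl
    (fun l => if l = i then Polynomial.C c else Polynomial.X) fun l => by
      split_ifs <;> simp
  simpa [restrictLine] using this

theorem eval_restrictLine (i : σ) (c t : ℝ) (p : MvPolynomial σ ℝ) :
    (restrictLine i c p).eval t = eval (fun l => if l = i then c else t) p := by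
  induction p using MvPolynomial.induction_on with
  | C a => simp
  | add p q hp hq => simp [hp, hq]
  | mul_X p l hp =>
    by_cases h : l = i
    · subst h; simp [hp]
    · simp [hp, restrictLine_X_of_ne h, h]

variable {i j : Fin 2}

theorem derivative_restrictLine (hij : j ≠ i) (c : ℝ) (p : Poly2) :
    (restrictLine i c p).derivative = restrictLine i c (pderiv j p) := by
  induction p using MvPolynomial.induction_on with
  | C a => simp
  | add p q hp hq => simp [hp, hq]
  | mul_X p l hp =>
    rw [map_mul, Polynomial.derivative_mul, hp, pderiv_mul, map_add, map_mul, map_mul]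
    by_cases h : l = i
    · subst h; simp [pderiv_X_of_ne hij.symm]
    · obtain rfl : l = j := by omega
      simp [restrictLine_X_of_ne h]

theorem X_sub_C_dvd_iff_restrictLine (i : Fin 2) (c : ℝ) (p : Poly2) :
    X i - C c ∣ p ↔ restrictLine i c p = 0 := by
  constructor
  · rintro ⟨q, rfl⟩
    simp
  · intro h
    obtain ⟨j, hij⟩ := exists_ne i
    let I : Ideal Poly2 := Ideal.span {X i - C c}
    have hX : Ideal.Quotient.mkₐ ℝ I (X i) = Ideal.Quotient.mkₐ ℝ I (C c) :=
      Ideal.Quotient.eq.2 (Ideal.mem_span_singleton_self _)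
    have hext : (Ideal.Quotient.mkₐ ℝ I).comp
        ((Polynomial.aeval (X j : Poly2)).comp (restrictLine i c)) =
        Ideal.Quotient.mkₐ ℝ I := by
      refine algHom_ext fun l => ?_
      by_cases hl : l = i
      · subst hl
        simp only [AlgHom.comp_apply, restrictLine_X_self, Polynomial.aeval_C, hX]
        rfl
      · obtain rfl : l = j := by omega
        simp [restrictLine_X_of_ne hl]
    have := DFunLike.congr_fun hext p
    simp only [AlgHom.comp_apply, h, map_zero] at this
    exact Ideal.mem_span_singleton.1 (Ideal.Quotient.eq_zero_iff_mem.1 this.symm)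

theorem prime_X_sub_C (i : Fin 2) (c : ℝ) : Prime (X i - C c : Poly2) := by
  refine ⟨fun h => ?_, fun h => ?_, fun a b h => ?_⟩
  · have := congrArg (eval fun _ => c + 1) h
    simp at this
  · have := h.map (restrictLine i c)
    simp at this
  · simpa only [X_sub_C_dvd_iff_restrictLine, map_mul, mul_eq_zero] using h

theorem X_sub_C_sq_dvd {c : ℝ} {p : Poly2} (h : restrictLine i c p = 0)
    (h' : restrictLine i c (pderiv i p) = 0) : (X i - C c) ^ 2 ∣ p := by
  obtain ⟨s, rfl⟩ := (X_sub_C_dvd_iff_restrictLine i c p).2 h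
  have hs : restrictLine i c s = 0 := by simpa [pderiv_mul] using h'
  rw [sq]
  exact mul_dvd_mul_left _ ((X_sub_C_dvd_iff_restrictLine i c s).2 hs)

/-- If the vertex, edge and normal derivative degrees of freedom on the edge of the unit square lying
on the line `X i = c` vanish, then `(X i - c) ^ 2` divides the polynomial. -/
theorem X_sub_C_sq_dvd_of_edge (hij : j ≠ i) {c : ℝ} {p : Poly2} {m : ℕ}
    (hdeg : p.totalDegree ≤ m + 3)
    (hvert : ∀ t : ℝ, t = 0 ∨ t = 1 →
      eval (fun l => if l = i then c else t) p = 0 ∧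
      eval (fun l => if l = i then c else t) (pderiv j p) = 0 ∧
      eval (fun l => if l = i then c else t) (pderiv i p) = 0 ∧
      eval (fun l => if l = i then c else t) (pderiv j (pderiv i p)) = 0)
    (hedge : ∀ n : ℕ, 0 < n → n < m + 1 →
      eval (fun l => if l = i then c else (n : ℝ) / (m + 1 : ℕ)) p = 0)
    (hnormal : ∀ n : ℕ, 0 < n → n < m →
      eval (fun l => if l = i then c else (n : ℝ) / m) (pderiv i p) = 0) :
    (X i - C c) ^ 2 ∣ p := by
  simp only [← eval_restrictLine, ← derivative_restrictLine hij] at hvert hedge hnormal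
  obtain ⟨a0, b0, c0, d0⟩ := hvert 0 (Or.inl rfl)
  obtain ⟨a1, b1, c1, d1⟩ := hvert 1 (Or.inr rfl)
  refine X_sub_C_sq_dvd ?_ ?_
  · exact Polynomial.eq_zero_of_hermite_nodes
      ((natDegree_restrictLine_le i c p).trans hdeg) a0 b0 a1 b1 hedge
  · have := (natDegree_restrictLine_le i c _).trans (totalDegree_pderiv_le i p)
    exact Polynomial.eq_zero_of_hermite_nodes (this.trans (by omega)) c0 d0 c1 d1 hnormal

theorem one_le_totalDegree_X_sub_C (i : Fin 2) (c : ℝ) :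
    1 ≤ (X i - C c : Poly2).totalDegree := by
  obtain ⟨j, hij⟩ := exists_ne i
  have := natDegree_restrictLine_le j 0 (X i - C c : Poly2)
  rwa [map_sub, restrictLine_X_of_ne hij.symm, restrictLine_C,
    Polynomial.natDegree_X_sub_C] at this

theorem add_two_le_totalDegree_X_sub_C_sq_mul (i : Fin 2) (c : ℝ) {q : Poly2} (hq : q ≠ 0) :
    q.totalDegree + 2 ≤ ((X i - C c) ^ 2 * q).totalDegree := by
  have h : (X i - C c : Poly2) ≠ 0 := (prime_X_sub_C i c).ne_zero
  have := one_le_totalDegree_X_sub_C i c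
  rw [totalDegree_mul_of_isDomain (pow_ne_zero 2 h) hq, sq, totalDegree_mul_of_isDomain h h]
  omega

theorem X_sub_C_sq_dvd_of_dvd_sq_mul {c : ℝ} {a b : Poly2} (ha : restrictLine i c a ≠ 0)
    (h : (X i - C c) ^ 2 ∣ a ^ 2 * b) : (X i - C c) ^ 2 ∣ b :=
  (prime_X_sub_C i c).pow_dvd_of_dvd_mul_left 2
    (fun hd => ha ((X_sub_C_dvd_iff_restrictLine i c a).1 ((prime_X_sub_C i c).dvd_of_dvd_pow hd))) h

theorem restrictLine_X_sub_C_ne_zero (hij : j ≠ i) (a c : ℝ) :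
    restrictLine i c (X j - C a) ≠ 0 := by
  rw [map_sub, restrictLine_X_of_ne hij, restrictLine_C]
  exact Polynomial.X_sub_C_ne_zero a

theorem restrictLine_X_self_sub_C_ne_zero {a c : ℝ} (h : c ≠ a) :
    restrictLine i c (X i - C a) ≠ 0 := by
  rw [map_sub, restrictLine_X_self, restrictLine_C, ← Polynomial.C_sub]
  exact Polynomial.C_ne_zero.2 (sub_ne_zero.2 h)

theorem exists_eq_bubble_mul {p : Poly2}
    (dx0 : (X 0 - C 0) ^ 2 ∣ p) (dx1 : (X 0 - C 1) ^ 2 ∣ p)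
    (dy0 : (X 1 - C 0) ^ 2 ∣ p) (dy1 : (X 1 - C 1) ^ 2 ∣ p) :
    ∃ q : Poly2, p = (X 0 - C 0) ^ 2 * ((X 0 - C 1) ^ 2 *
      ((X 1 - C 0) ^ 2 * ((X 1 - C 1) ^ 2 * q))) := by
  have h01 : (0 : Fin 2) ≠ 1 := by decide
  obtain ⟨q₁, rfl⟩ := dx0
  have dx1' := X_sub_C_sq_dvd_of_dvd_sq_mul
    (restrictLine_X_self_sub_C_ne_zero one_ne_zero) dx1
  have dy0' := X_sub_C_sq_dvd_of_dvd_sq_mul (restrictLine_X_sub_C_ne_zero h01 0 0) dy0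
  have dy1' := X_sub_C_sq_dvd_of_dvd_sq_mul (restrictLine_X_sub_C_ne_zero h01 0 1) dy1
  clear dx1 dy0 dy1
  obtain ⟨q₂, rfl⟩ := dx1'
  have dy0 := X_sub_C_sq_dvd_of_dvd_sq_mul (restrictLine_X_sub_C_ne_zero h01 1 0) dy0'
  have dy1 := X_sub_C_sq_dvd_of_dvd_sq_mul (restrictLine_X_sub_C_ne_zero h01 1 1) dy1'
  clear dy0' dy1'
  obtain ⟨q₃, rfl⟩ := dy0
  obtain ⟨q, rfl⟩ := X_sub_C_sq_dvd_of_dvd_sq_mul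
    (restrictLine_X_self_sub_C_ne_zero one_ne_zero) dy1
  exact ⟨q, rfl⟩

end MvPolynomial

/-- a `P_k` polynomial (`k ≥ 4`) annihilated by all vertex and edge degrees of
freedom factors as `x²(1-x)²y²(1-y)² q` with `q ∈ P_{k-8}` (and `q = 0`, hence `p = 0`,
when `k ≤ 7`). -/
theorem stmt_7
    (k : ℕ) (hk : 4 ≤ k)
    (p : Poly2) (hp : p.totalDegree ≤ k)
    (hvert : ∀ z ∈ ({(0, 0), (1, 0), (1, 1), (0, 1)} : Set (ℝ × ℝ)),
      ev p z.1 z.2 = 0 ∧ ev (dX p) z.1 z.2 = 0 ∧ ev (dY p) z.1 z.2 = 0 ∧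
        ev (dX (dY p)) z.1 z.2 = 0)
    (hedge : ∀ j : ℕ, 1 ≤ j → j ≤ k - 3 →
      ev p ((j : ℝ) / ((k : ℝ) - 2)) 0 = 0 ∧ ev p ((j : ℝ) / ((k : ℝ) - 2)) 1 = 0 ∧
      ev p 0 ((j : ℝ) / ((k : ℝ) - 2)) = 0 ∧ ev p 1 ((j : ℝ) / ((k : ℝ) - 2)) = 0)
    (hnormal : ∀ j : ℕ, 1 ≤ j → j ≤ k - 4 →
      ev (dY p) ((j : ℝ) / ((k : ℝ) - 3)) 0 = 0 ∧ ev (dY p) ((j : ℝ) / ((k : ℝ) - 3)) 1 = 0 ∧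
      ev (dX p) 0 ((j : ℝ) / ((k : ℝ) - 3)) = 0 ∧ ev (dX p) 1 ((j : ℝ) / ((k : ℝ) - 3)) = 0) :
    ∃ q : Poly2,
      p = (MvPolynomial.X 0) ^ 2 * (1 - MvPolynomial.X 0) ^ 2 *
            (MvPolynomial.X 1) ^ 2 * (1 - MvPolynomial.X 1) ^ 2 * q ∧
      (8 ≤ k → q.totalDegree ≤ k - 8) ∧ (k ≤ 7 → q = 0 ∧ p = 0) := by
  obtain ⟨m, rfl⟩ : ∃ m, k = m + 3 := ⟨k - 3, by omega⟩
  have e1 : (((m + 3 : ℕ) : ℝ) - 2) = ((m + 1 : ℕ) : ℝ) := by push_cast; ring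
  have e2 : (((m + 3 : ℕ) : ℝ) - 3) = (m : ℝ) := by push_cast; ring
  rw [e1] at hedge
  rw [e2] at hnormal
  have v0 : ∀ c t : ℝ, (fun l : Fin 2 => if l = 0 then c else t) = ![c, t] := fun c t => by
    ext l; fin_cases l <;> simp
  have v1 : ∀ c t : ℝ, (fun l : Fin 2 => if l = 1 then c else t) = ![t, c] := fun c t => by
    ext l; fin_cases l <;> simp
  simp only [Set.mem_insert_iff, Set.mem_singleton_iff, forall_eq_or_imp, forall_eq, ev, dX,
    dY] at hvert
  simp only [ev, dX, dY] at hedge hnormal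
  obtain ⟨h00, h10, h11, h01⟩ := hvert
  have dx : ∀ c : ℝ, c = 0 ∨ c = 1 → (X 0 - C c : Poly2) ^ 2 ∣ p := by
    intro c hc
    refine X_sub_C_sq_dvd_of_edge (j := 1) (by decide) hp ?_ ?_ ?_
    · intro t ht
      rw [v0, pderiv_comm 1 0]
      rcases hc with rfl | rfl <;> rcases ht with rfl | rfl
      exacts [⟨h00.1, h00.2.2.1, h00.2.1, h00.2.2.2⟩, ⟨h01.1, h01.2.2.1, h01.2.1, h01.2.2.2⟩,
        ⟨h10.1, h10.2.2.1, h10.2.1, h10.2.2.2⟩, ⟨h11.1, h11.2.2.1, h11.2.1, h11.2.2.2⟩]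
    · intro n hn hn'
      have := hedge n (by omega) (by omega)
      rw [v0]
      rcases hc with rfl | rfl
      exacts [this.2.2.1, this.2.2.2]
    · intro n hn hn'
      have := hnormal n (by omega) (by omega)
      rw [v0]
      rcases hc with rfl | rfl
      exacts [this.2.2.1, this.2.2.2]
  have dy : ∀ c : ℝ, c = 0 ∨ c = 1 → (X 1 - C c : Poly2) ^ 2 ∣ p := by
    intro c hc
    refine X_sub_C_sq_dvd_of_edge (j := 0) (by decide) hp ?_ ?_ ?_
    · intro t ht
      rw [v1]
      rcases hc with rfl | rfl <;> rcases ht with rfl | rfl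
      exacts [h00, h10, h01, h11]
    · intro n hn hn'
      have := hedge n (by omega) (by omega)
      rw [v1]
      rcases hc with rfl | rfl
      exacts [this.1, this.2.1]
    · intro n hn hn'
      have := hnormal n (by omega) (by omega)
      rw [v1]
      rcases hc with rfl | rfl
      exacts [this.1, this.2.1]
  obtain ⟨q, h₁⟩ := exists_eq_bubble_mul (dx 0 (Or.inl rfl)) (dx 1 (Or.inr rfl))
    (dy 0 (Or.inl rfl)) (dy 1 (Or.inr rfl))
  have hdeg : q ≠ 0 → q.totalDegree + 8 ≤ m + 3 := fun hq => by
    have hne : ∀ (i : Fin 2) (c : ℝ), (X i - C c : Poly2) ^ 2 ≠ 0 := fun i c =>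
      pow_ne_zero 2 (prime_X_sub_C i c).ne_zero
    have d₁ := add_two_le_totalDegree_X_sub_C_sq_mul 1 1 hq
    have n₁ := mul_ne_zero (hne 1 1) hq
    have d₂ := add_two_le_totalDegree_X_sub_C_sq_mul 1 0 n₁
    have n₂ := mul_ne_zero (hne 1 0) n₁
    have d₃ := add_two_le_totalDegree_X_sub_C_sq_mul 0 1 n₂
    have d₄ := add_two_le_totalDegree_X_sub_C_sq_mul 0 0 (mul_ne_zero (hne 0 1) n₂)
    rw [← h₁] at d₄
    omega
  refine ⟨q, ?_, fun _ => ?_, fun hk7 => ?_⟩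
  · rw [h₁, C_0, C_1]
    ring
  · by_cases hq : q = 0
    · simp [hq]
    · have := hdeg hq
      omega
  · have hq : q = 0 := by
      by_contra hq
      have := hdeg hq
      omega
    exact ⟨hq, by rw [h₁, hq]; simp⟩
end
end

section
/- Let b1,…,b7 be functions in the Bell space W_5(T) satisfying the dual-basis conditions: every Bell degree-of-freedom functional (for k=5) vanishes on each b_i, except that b1(1/3,0)=1, b2(2/3,0)=1, b3(1,0)=1, ∂_y b4(1/2,0)=1, ∂_x b5(1,0)=1, ∂_y b6(1,0)=1, ∂_{xy} b7(1,0)=1, each b_i taking value 1 only at its own designated functional and 0 at all other Bell functionals. Then P_5 ∩ span{b1,…,b7} = {0}, i.e. if p + c1·b1 + … + c7·b7 = 0 with p ∈ P_5 and real c_i, then p = 0 and all c_i = 0; consequently the space V_5(T) = P_5 + span{b1,…,b7} has dimension 28. -/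
open MvPolynomial

noncomputable section

/-- The monomial exponent `(i, j)`, i.e. the exponent of `x ^ i * y ^ j`. -/
def expo (m : ℕ × ℕ) : Fin 2 →₀ ℕ := Finsupp.single 0 m.1 + Finsupp.single 1 m.2

theorem expo_injective : Function.Injective expo := by
  rintro ⟨i, j⟩ ⟨k, l⟩ h
  have h0 := DFunLike.congr_fun h 0
  have h1 := DFunLike.congr_fun h 1
  simp only [expo, Finsupp.add_apply, Finsupp.single_apply] at h0 h1
  simp_all

theorem eq_expo (m : Fin 2 →₀ ℕ) : m = expo (m 0, m 1) := by
  ext i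
  fin_cases i <;> simp [expo]

/-- The pairs of natural numbers with sum at most `n`. -/
def triangle (n : ℕ) : Finset (ℕ × ℕ) :=
  {m ∈ Finset.range (n + 1) ×ˢ Finset.range (n + 1) | m.1 + m.2 ≤ n}

/-- The exponents of total degree at most `n`. -/
def exponents (n : ℕ) : Finset (Fin 2 →₀ ℕ) := (triangle n).image expo

theorem mem_exponents {n : ℕ} {m : Fin 2 →₀ ℕ} :
    m ∈ exponents n ↔ (m.sum fun _ e => e) ≤ n := by
  rw [Finsupp.sum_fintype _ _ fun _ => rfl, Fin.sum_univ_two]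
  simp only [exponents, triangle, Finset.mem_image, Finset.mem_filter, Finset.mem_product,
    Finset.mem_range]
  constructor
  · rintro ⟨⟨i, j⟩, ⟨-, h⟩, rfl⟩
    simpa [expo] using h
  · exact fun h => ⟨(m 0, m 1), ⟨by omega, h⟩, (eq_expo m).symm⟩

theorem coe_exponents (n : ℕ) :
    (exponents n : Set (Fin 2 →₀ ℕ)) = {m | (m.sum fun _ e => e) ≤ n} := by
  ext m
  exact mem_exponents

theorem card_exponents_five : (exponents 5).card = 21 := by
  rw [exponents, Finset.card_image_of_injective _ expo_injective]
  decide

theorem finrank_restrictTotalDegree_five :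
    Module.finrank ℝ (restrictTotalDegree (Fin 2) ℝ 5) = 21 := by
  rw [restrictTotalDegree, ← coe_exponents,
    Module.finrank_eq_card_basis (basisRestrictSupport ℝ _)]
  simpa using card_exponents_five

theorem eq_sum_monomial {p : Poly2} {n : ℕ} (hp : p.totalDegree ≤ n) :
    p = ∑ m ∈ triangle n, monomial (expo m) (p.coeff (expo m)) := by
  rw [← Finset.sum_image (f := fun e => monomial e (p.coeff e)) expo_injective.injOn]
  conv_lhs => rw [p.as_sum]
  refine Finset.sum_subset (fun m hm => ?_) fun m _ hm => ?_
  · exact mem_exponents.2 ((le_totalDegree hm).trans hp)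
  · rw [notMem_support_iff.1 hm, monomial_zero]

theorem monomial_expo (m : ℕ × ℕ) (c : ℝ) :
    (monomial (expo m) c : Poly2) = C c * (X 0 ^ m.1 * X 1 ^ m.2) := by
  rw [X_pow_eq_monomial, X_pow_eq_monomial, monomial_mul, C_mul_monomial, expo]
  simp

/-- The functional `v ↦ v(a, b)`. -/
def value (a b : ℝ) : Poly2 →ₗ[ℝ] ℝ := (aeval ![a, b] : Poly2 →ₐ[ℝ] ℝ).toLinearMap

/-- The functional `v ↦ ∂ₓ v(a, b)`. -/
def derivX (a b : ℝ) : Poly2 →ₗ[ℝ] ℝ := value a b ∘ₗ (pderiv 0).toLinearMap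

/-- The functional `v ↦ ∂_y v(a, b)`. -/
def derivY (a b : ℝ) : Poly2 →ₗ[ℝ] ℝ := value a b ∘ₗ (pderiv 1).toLinearMap

/-- The functional `v ↦ ∂ₓ∂_y v(a, b)`. -/
def derivXY (a b : ℝ) : Poly2 →ₗ[ℝ] ℝ := derivX a b ∘ₗ (pderiv 1).toLinearMap

section Apply

variable (a b : ℝ)

theorem coe_value : ⇑(value a b) = fun v => ev v a b := by
  ext v
  simp [value, ev, aeval_eq_eval]

theorem coe_derivX : ⇑(derivX a b) = fun v => ev (dX v) a b := by
  ext v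
  simp [derivX, coe_value, dX]

theorem coe_derivY : ⇑(derivY a b) = fun v => ev (dY v) a b := by
  ext v
  simp [derivY, coe_value, dY]

theorem coe_derivXY : ⇑(derivXY a b) = fun v => ev (dX (dY v)) a b := by
  ext v
  simp [derivXY, coe_derivX, dY]

theorem value_monomial (m : ℕ × ℕ) (c : ℝ) :
    value a b (monomial (expo m) c) = c * (a ^ m.1 * b ^ m.2) := by
  simp [monomial_expo, coe_value, ev]

theorem derivX_monomial (m : ℕ × ℕ) (c : ℝ) :
    derivX a b (monomial (expo m) c) = c * (m.1 * a ^ (m.1 - 1) * b ^ m.2) := by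
  simp [monomial_expo, coe_derivX, ev, dX, pderiv_X]
  exact Or.inl (by ring)

theorem derivY_monomial (m : ℕ × ℕ) (c : ℝ) :
    derivY a b (monomial (expo m) c) = c * (a ^ m.1 * (m.2 * b ^ (m.2 - 1))) := by
  simp [monomial_expo, coe_derivY, ev, dY, pderiv_X]

theorem derivXY_monomial (m : ℕ × ℕ) (c : ℝ) :
    derivXY a b (monomial (expo m) c) =
      c * (m.1 * a ^ (m.1 - 1) * (m.2 * b ^ (m.2 - 1))) := by
  simp [monomial_expo, coe_derivXY, ev, dX, dY, pderiv_X]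
  exact Or.inl (by ring)

end Apply

/-- A polynomial of total degree at most five is determined by the Bell degrees of freedom that
are not attached to the edge `y = 0` away from the vertex `(0, 0)`. -/
theorem eq_zero_of_dofs_s14 {p : Poly2} (hp : p.totalDegree ≤ 5)
    (hv : ∀ i j : ℕ, i ≤ 3 → j ≤ 3 → (i = 0 ∨ 0 < j) → value (i / 3) (j / 3) p = 0)
    (hx : ∀ i j : ℕ, i ≤ 1 → j ≤ 2 → (i = 0 ∨ 0 < j) → derivX i (j / 2) p = 0)
    (hy : ∀ i j : ℕ, i ≤ 2 → j ≤ 1 → (i = 0 ∨ 0 < j) → derivY (i / 2) j p = 0)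
    (hxy : ∀ i j : ℕ, i ≤ 1 → j ≤ 1 → (i = 0 ∨ 0 < j) → derivXY i j p = 0) :
    p = 0 := by
  have hsum := eq_sum_monomial hp
  generalize ha : (fun m => p.coeff (expo m)) = a
  replace ha : ∀ m, p.coeff (expo m) = a m := fun m => by rw [← ha]
  simp only [ha] at hsum
  clear ha
  subst hsum
  simp only [map_sum, value_monomial] at hv
  simp only [map_sum, derivX_monomial] at hx
  simp only [map_sum, derivY_monomial] at hy
  simp only [map_sum, derivXY_monomial] at hxy
  clear hp
  refine Finset.sum_eq_zero fun m hm => ?_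
  suffices h : a m = 0 by rw [h, monomial_zero]
  simp only [triangle, Finset.sum_filter, Finset.sum_product, Finset.sum_range_succ,
    Finset.sum_range_zero] at hv hx hy hxy
  norm_num at hv hx hy hxy
  have f0 := hv 0 0
  have f1 := hv 0 1
  have f2 := hv 0 2
  have f3 := hv 0 3
  have f4 := hy 0 0
  have f5 := hy 0 1
  norm_num at f0 f1 f2 f3 f4 f5
  have a00 : a (0, 0) = 0 := by linarith
  have a01 : a (0, 1) = 0 := by linarith
  have a02 : a (0, 2) = 0 := by linarith
  have a03 : a (0, 3) = 0 := by linarith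
  have a04 : a (0, 4) = 0 := by linarith
  have a05 : a (0, 5) = 0 := by linarith
  have g0 := hx 0 0
  have g1 := hx 0 1
  have g2 := hx 0 2
  have g3 := hxy 0 0
  have g4 := hxy 0 1
  norm_num [a00, a01, a02, a03, a04, a05] at g0 g1 g2 g3 g4
  have a10 : a (1, 0) = 0 := by linarith
  have a11 : a (1, 1) = 0 := by linarith
  have a12 : a (1, 2) = 0 := by linarith
  have a13 : a (1, 3) = 0 := by linarith
  have a14 : a (1, 4) = 0 := by linarith
  have k0 := hv 1 3
  have k1 := hv 2 3
  have k2 := hv 3 3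
  have k3 := hx 1 2
  have k4 := hy 1 1
  have k5 := hy 2 1
  have k6 := hxy 1 1
  have k7 := hv 3 1
  have k8 := hv 3 2
  have k9 := hx 1 1
  norm_num [a00, a01, a02, a03, a04, a05, a10, a11, a12, a13, a14]
    at k0 k1 k2 k3 k4 k5 k6 k7 k8 k9
  have a20 : a (2, 0) = 0 := by linarith
  have a21 : a (2, 1) = 0 := by linarith
  have a22 : a (2, 2) = 0 := by linarith
  have a23 : a (2, 3) = 0 := by linarith
  have a30 : a (3, 0) = 0 := by linarith
  have a31 : a (3, 1) = 0 := by linarith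
  have a32 : a (3, 2) = 0 := by linarith
  have a40 : a (4, 0) = 0 := by linarith
  have a41 : a (4, 1) = 0 := by linarith
  have a50 : a (5, 0) = 0 := by linarith
  obtain ⟨i, j⟩ := m
  simp only [triangle, Finset.mem_filter] at hm
  have hij := hm.2
  have hi : i ≤ 5 := by omega
  have hj : j ≤ 5 := by omega
  interval_cases i <;> interval_cases j <;> first | assumption | omega

/-- The degrees of freedom attached to the edge `y = 0` away from the vertex `(0, 0)`. -/
def edgeDof : Fin 7 → Poly2 →ₗ[ℝ] ℝ :=
  ![value (1 / 3) 0, value (2 / 3) 0, value 1 0, derivY (1 / 2) 0, derivX 1 0, derivY 1 0,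
    derivXY 1 0]

section BellDofs

variable {i j : ℕ}

theorem value_mem_bellDofs (hi : i ≤ 3) (hj : j ≤ 3) :
    ⇑(value (i / 3) (j / 3)) ∈ BellDofs 5 :=
  Or.inl ⟨i, j, hi, hj, by rw [coe_value]; norm_num⟩

theorem derivX_mem_bellDofs (hi : i ≤ 1) (hj : j ≤ 2) : ⇑(derivX i (j / 2)) ∈ BellDofs 5 :=
  Or.inr <| Or.inl ⟨i, j, hi, hj, by rw [coe_derivX]; norm_num⟩

theorem derivY_mem_bellDofs (hi : i ≤ 2) (hj : j ≤ 1) : ⇑(derivY (i / 2) j) ∈ BellDofs 5 :=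
  Or.inr <| Or.inr <| Or.inl ⟨i, j, hi, hj, by rw [coe_derivY]; norm_num⟩

theorem derivXY_mem_bellDofs (hi : i ≤ 1) (hj : j ≤ 1) : ⇑(derivXY i j) ∈ BellDofs 5 :=
  Or.inr <| Or.inr <| Or.inr ⟨i, j, hi, hj, by rw [coe_derivXY]⟩

theorem edgeDof_mem_bellDofs (k : Fin 7) : ⇑(edgeDof k) ∈ BellDofs 5 := by
  fin_cases k
  · simpa [edgeDof] using value_mem_bellDofs (i := 1) (j := 0) (by simp) (by simp)
  · simpa [edgeDof] using value_mem_bellDofs (i := 2) (j := 0) (by simp) (by simp)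
  · simpa [edgeDof] using value_mem_bellDofs (i := 3) (j := 0) (by simp) (by simp)
  · simpa [edgeDof] using derivY_mem_bellDofs (i := 1) (j := 0) (by simp) (by simp)
  · simpa [edgeDof] using derivX_mem_bellDofs (i := 1) (j := 0) (by simp) (by simp)
  · simpa [edgeDof] using derivY_mem_bellDofs (i := 2) (j := 0) (by simp) (by simp)
  · simpa [edgeDof] using derivXY_mem_bellDofs (i := 1) (j := 0) (by simp) (by simp)

end BellDofs

/-- A polynomial on which each `edgeDof` differs from all other Bell degrees of freedom. -/
def sep : Poly2 := 2 * X 0 ^ 2 * X 1 + X 0 * X 1 ^ 2 - X 0 - X 1 - X 0 ^ 2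

section Sep

variable (a b : ℝ)

theorem value_sep : value a b sep = 2 * a ^ 2 * b + a * b ^ 2 - a - b - a ^ 2 := by
  simp [coe_value, ev, sep]

theorem derivX_sep : derivX a b sep = 4 * a * b + b ^ 2 - 1 - 2 * a := by
  have h : pderiv (0 : Fin 2) (2 : Poly2) = 0 := pderiv_C (a := 2)
  simp [coe_derivX, ev, dX, sep, pderiv_X, h]
  ring

theorem derivY_sep : derivY a b sep = 2 * a ^ 2 + 2 * a * b - 1 := by
  have h : pderiv (1 : Fin 2) (2 : Poly2) = 0 := pderiv_C (a := 2)
  simp [coe_derivY, ev, dY, sep, pderiv_X, h]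
  ring

theorem derivXY_sep : derivXY a b sep = 4 * a + 2 * b := by
  have h (i : Fin 2) : pderiv i (2 : Poly2) = 0 := pderiv_C (a := 2)
  simp [coe_derivXY, ev, dX, dY, sep, pderiv_X, h]
  ring

theorem edgeDof_sep (k : Fin 7) :
    edgeDof k sep = (![-4 / 9, -10 / 9, -2, -1 / 2, -3, 1, 4] : Fin 7 → ℝ) k := by
  fin_cases k <;> norm_num [edgeDof, value_sep, derivX_sep, derivY_sep, derivXY_sep]

end Sep

section Dual

variable {b : Fin 7 → Poly2}

theorem map_sum_eq_zero (hb : ∀ k, IsDualTo 5 (edgeDof k) (b k)) (c : Fin 7 → ℝ)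
    {F : Poly2 →ₗ[ℝ] ℝ} (hF : ⇑F ∈ BellDofs 5)
    (hsep : ∀ k, F sep ≠ edgeDof k sep) : F (∑ k, c k • b k) = 0 := by
  rw [map_sum]
  refine Finset.sum_eq_zero fun k _ => ?_
  rw [map_smul, (hb k).2 F hF fun h => hsep k (congr_fun h sep), smul_zero]

theorem edgeDof_sum (hb : ∀ k, IsDualTo 5 (edgeDof k) (b k)) (c : Fin 7 → ℝ) (k : Fin 7) :
    edgeDof k (∑ l, c l • b l) = c k := by
  rw [map_sum, Finset.sum_eq_single k]
  · rw [map_smul, (hb k).1, smul_eq_mul, mul_one]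
  · intro l _ hlk
    rw [map_smul, (hb l).2 _ (edgeDof_mem_bellDofs k), smul_zero]
    intro h
    have hsep := congr_fun h sep
    rw [edgeDof_sep, edgeDof_sep] at hsep
    fin_cases k <;> fin_cases l <;> first | exact hlk rfl | norm_num at hsep
  · simp

theorem sum_eq_zero_of_totalDegree_le (hb : ∀ k, IsDualTo 5 (edgeDof k) (b k))
    (c : Fin 7 → ℝ) (hdeg : (∑ k, c k • b k).totalDegree ≤ 5) :
    ∑ k, c k • b k = 0 := by
  refine eq_zero_of_dofs_s14 hdeg ?_ ?_ ?_ ?_ <;> intro i j hi hj hij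
  · refine map_sum_eq_zero hb c (value_mem_bellDofs hi hj) fun k => ?_
    rw [edgeDof_sep, value_sep]
    interval_cases i <;> interval_cases j <;> first | omega | fin_cases k <;> norm_num
  · refine map_sum_eq_zero hb c (derivX_mem_bellDofs hi hj) fun k => ?_
    rw [edgeDof_sep, derivX_sep]
    interval_cases i <;> interval_cases j <;> first | omega | fin_cases k <;> norm_num
  · refine map_sum_eq_zero hb c (derivY_mem_bellDofs hi hj) fun k => ?_
    rw [edgeDof_sep, derivY_sep]
    interval_cases i <;> interval_cases j <;> first | omega | fin_cases k <;> norm_num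
  · refine map_sum_eq_zero hb c (derivXY_mem_bellDofs hi hj) fun k => ?_
    rw [edgeDof_sep, derivXY_sep]
    interval_cases i <;> interval_cases j <;> first | omega | fin_cases k <;> norm_num

end Dual

/-- `P₅ ∩ span{b₁,…,b₇} = {0}`, and the bubble-enriched space
`V₅(T) = P₅ + span{b₁,…,b₇}` has dimension `28`. -/
theorem stmt_14
    (b : Fin 7 → Poly2)
    (hW : ∀ i, BellSpace 5 (b i))
    (hb1 : IsDualTo 5 (fun v => ev v (1 / 3) 0) (b 0))
    (hb2 : IsDualTo 5 (fun v => ev v (2 / 3) 0) (b 1))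
    (hb3 : IsDualTo 5 (fun v => ev v 1 0) (b 2))
    (hb4 : IsDualTo 5 (fun v => ev (dY v) (1 / 2) 0) (b 3))
    (hb5 : IsDualTo 5 (fun v => ev (dX v) 1 0) (b 4))
    (hb6 : IsDualTo 5 (fun v => ev (dY v) 1 0) (b 5))
    (hb7 : IsDualTo 5 (fun v => ev (dX (dY v)) 1 0) (b 6)) :
    (∀ (p : Poly2), p.totalDegree ≤ 5 → ∀ c : Fin 7 → ℝ,
      p + ∑ i, c i • b i = 0 → p = 0 ∧ ∀ i, c i = 0) ∧
    Module.finrank ℝ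
      ↥(MvPolynomial.restrictTotalDegree (Fin 2) ℝ 5 ⊔
          Submodule.span ℝ (Set.range b)) = 28 := by
  have hb : ∀ k, IsDualTo 5 (edgeDof k) (b k) := by
    intro k
    fin_cases k <;> simpa [edgeDof, coe_value, coe_derivX, coe_derivY, coe_derivXY, -one_div]
  have hind (p : Poly2) (hp : p.totalDegree ≤ 5) (c : Fin 7 → ℝ) (h : p + ∑ i, c i • b i = 0) :
      p = 0 ∧ ∀ i, c i = 0 := by
    have hsum : ∑ i, c i • b i = 0 := by
      apply sum_eq_zero_of_totalDegree_le hb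
      rwa [eq_neg_of_add_eq_zero_right h, totalDegree_neg]
    refine ⟨by rwa [hsum, add_zero] at h, fun i => ?_⟩
    rw [← edgeDof_sum hb c i, hsum, map_zero]
  refine ⟨hind, ?_⟩
  have hli : LinearIndependent ℝ b := Fintype.linearIndependent_iff.2 fun c hc =>
    (hind 0 (by simp) c (by rw [hc, add_zero])).2
  have hinf : restrictTotalDegree (Fin 2) ℝ 5 ⊓ Submodule.span ℝ (Set.range b) = ⊥ := by
    rw [eq_bot_iff]
    rintro p ⟨hp, hpb⟩
    obtain ⟨c, rfl⟩ := (Submodule.mem_span_range_iff_exists_fun ℝ).1 hpb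
    exact sum_eq_zero_of_totalDegree_le hb c ((mem_restrictTotalDegree _ _ _).1 hp)
  have : FiniteDimensional ℝ (Submodule.span ℝ (Set.range b)) :=
    FiniteDimensional.span_of_finite ℝ (Set.finite_range b)
  have hfin := Submodule.finrank_sup_add_finrank_inf_eq
    (restrictTotalDegree (Fin 2) ℝ 5) (Submodule.span ℝ (Set.range b))
  rwa [hinf, finrank_bot, add_zero, finrank_restrictTotalDegree_five,
    finrank_span_eq_card hli, Fintype.card_fin] at hfin
end
end
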